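/- arXiv:1112.1338 — 5 statements merged into one kernel-verified Lean document; each statement's English description precedes it below -/
import Mathlib

section
/- Under assumptions A1 (stochasticity), A2 (self-confidence with constant η ∈ (0,1)) and A3 (arc balance with constant A > 1), the discrete-time belief evolution achieves global ε-agreement if and only if (a) the persistent graph G^p is quasi-strongly connected, and (b) there exist a constant a* > 0 and an integer T* ≥ 1 such that ∑_{s=t}^{t+T*-1} W_ij(s) ≥ a* for every t ∈ ℕ and every persistent arc (j,i) of G^p. -/
open Filter Finset

/-- `ReachIn R k i j`: `j` can be reached from `i` in exactly `k` steps following relation `R`. -/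
def ReachIn {α : Type*} (R : α → α → Prop) : ℕ → α → α → Prop
  | 0 => fun i j => i = j
  | k + 1 => fun i j => ∃ m, R i m ∧ ReachIn R k m j

/-- Distance from `i` to `j`: length of a shortest directed path. -/
noncomputable def distR {α : Type*} (R : α → α → Prop) (i j : α) : ℕ :=
  sInf {k | ReachIn R k i j}

/-- Diameter: maximum of `distR i j` over pairs with `j` reachable from `i`. -/
noncomputable def diamR {α : Type*} (R : α → α → Prop) : ℕ :=
  sSup {d | ∃ i j, (∃ k, ReachIn R k i j) ∧ d = distR R i j}

/-- Discrete-time belief evolution trajectory starting at time `t0`. -/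
def DTraj (n : ℕ) (W : ℕ → Fin n → Fin n → ℝ) (t0 : ℕ) (x : ℕ → Fin n → ℝ) : Prop :=
  ∀ t, t0 ≤ t → ∀ i, x (t + 1) i = ∑ j, W t i j * x t j

/-- Maximum state Ψ(t). -/
noncomputable def dMax (n : ℕ) (x : ℕ → Fin n → ℝ) (t : ℕ) : ℝ := ⨆ i, x t i

/-- Minimum state ψ(t). -/
noncomputable def dMin (n : ℕ) (x : ℕ → Fin n → ℝ) (t : ℕ) : ℝ := ⨅ i, x t i

/-- Agreement measure H(t) = Ψ(t) − ψ(t). -/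
noncomputable def dH (n : ℕ) (x : ℕ → Fin n → ℝ) (t : ℕ) : ℝ := dMax n x t - dMin n x t

/-- `(j,i)` is a persistent arc: `j ≠ i` and `∑_{t=0}^∞ W_ij(t) = ∞`. -/
def DPersistent (n : ℕ) (W : ℕ → Fin n → Fin n → ℝ) (j i : Fin n) : Prop :=
  j ≠ i ∧ Tendsto (fun T => ∑ t ∈ Finset.range T, W t i j) atTop atTop

/-- The persistent graph is quasi-strongly connected: it has a center. -/
def DQSC (n : ℕ) (W : ℕ → Fin n → Fin n → ℝ) : Prop :=
  ∃ c : Fin n, ∀ v : Fin n, ∃ k, ReachIn (DPersistent n W) k c v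

/-- Global agreement for the discrete-time evolution. -/
def DAgree (n : ℕ) (W : ℕ → Fin n → Fin n → ℝ) : Prop :=
  ∀ t0 : ℕ, ∀ x : ℕ → Fin n → ℝ, DTraj n W t0 x → Tendsto (dH n x) atTop (nhds 0)

/-- Global ε-agreement for the discrete-time evolution. -/
def DEpsAgree (n : ℕ) (W : ℕ → Fin n → Fin n → ℝ) : Prop :=
  ∃ ε : ℝ, 0 < ε ∧ ε < 1 ∧ ∃ T0 : ℕ, 1 ≤ T0 ∧
    ∀ t0 : ℕ, ∀ x : ℕ → Fin n → ℝ, DTraj n W t0 x →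
      ∀ t, t0 ≤ t → dH n x (t + T0) ≤ ε * dH n x t

/-- Condition (b): uniformly positive weight sums over windows of length `T` for persistent arcs. -/
def DArcCond (n : ℕ) (W : ℕ → Fin n → Fin n → ℝ) : Prop :=
  ∃ a : ℝ, 0 < a ∧ ∃ T : ℕ, 1 ≤ T ∧
    ∀ t : ℕ, ∀ j i : Fin n, DPersistent n W j i →
      a ≤ ∑ s ∈ Finset.Ico t (t + T), W s i j

/-- ξ⁺(t;m) = ∑_{j ≠ m} W_mj(t). -/
def dXi (n : ℕ) (W : ℕ → Fin n → Fin n → ℝ) (t : ℕ) (m : Fin n) : ℝ :=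
  ∑ j ∈ Finset.univ.erase m, W t m j

theorem aux_shift {n : ℕ} {W : ℕ → Fin n → Fin n → ℝ} {t0 : ℕ} {x : ℕ → Fin n → ℝ}
    (hA1 : ∀ t i, ∑ j, W t i j = 1) (hx : DTraj n W t0 x) (c d : ℝ) :
    DTraj n W t0 (fun t i => c * x t i + d) := by
  intro t ht i
  simp only [hx t ht i, mul_add, Finset.sum_add_distrib, ← Finset.sum_mul, hA1 t i, Finset.mul_sum]
  rw [one_mul]
  congr 1
  exact Finset.sum_congr rfl fun j _ => by ring

theorem aux_nonneg {n : ℕ} {W : ℕ → Fin n → Fin n → ℝ} {t0 : ℕ} {y : ℕ → Fin n → ℝ}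
    (hW0 : ∀ t i j, 0 ≤ W t i j) (hy : DTraj n W t0 y) (h0 : ∀ i, 0 ≤ y t0 i) :
    ∀ k i, 0 ≤ y (t0 + k) i := by
  intro k
  induction k with
  | zero => exact h0
  | succ k ih =>
    intro i
    rw [← add_assoc, hy (t0 + k) (by omega) i]
    exact Finset.sum_nonneg fun j _ => mul_nonneg (hW0 _ _ _) (ih j)

theorem aux_term {n : ℕ} {W : ℕ → Fin n → Fin n → ℝ} {t0 : ℕ} {y : ℕ → Fin n → ℝ}
    (hW0 : ∀ t i j, 0 ≤ W t i j) (hy : DTraj n W t0 y) (h0 : ∀ i, 0 ≤ y t0 i)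
    (k : ℕ) (i j : Fin n) : W (t0 + k) i j * y (t0 + k) j ≤ y (t0 + k + 1) i := by
  rw [hy (t0 + k) (by omega) i]
  exact Finset.single_le_sum (f := fun j => W (t0 + k) i j * y (t0 + k) j)
    (fun j _ => mul_nonneg (hW0 _ _ _) (aux_nonneg hW0 hy h0 k j)) (Finset.mem_univ j)

theorem aux_mono {n : ℕ} {W : ℕ → Fin n → Fin n → ℝ} {t0 t1 : ℕ} {y : ℕ → Fin n → ℝ}
    (h : t0 ≤ t1) (hy : DTraj n W t0 y) : DTraj n W t1 y :=
  fun t ht i => hy t (h.trans ht) i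

theorem aux_self {n : ℕ} {W : ℕ → Fin n → Fin n → ℝ} {t0 : ℕ} {y : ℕ → Fin n → ℝ}
    (hW0 : ∀ t i j, 0 ≤ W t i j) {η : ℝ} (hη0 : 0 < η) (hA2 : ∀ t i, η ≤ W t i i)
    (hy : DTraj n W t0 y) (h0 : ∀ i, 0 ≤ y t0 i) (k : ℕ) (i : Fin n) :
    η ^ k * y t0 i ≤ y (t0 + k) i := by
  induction k with
  | zero => simp
  | succ k ih =>
    calc η ^ (k+1) * y t0 i = η * (η ^ k * y t0 i) := by ring
      _ ≤ η * y (t0 + k) i := by gcongr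
      _ ≤ W (t0 + k) i i * y (t0 + k) i :=
        mul_le_mul_of_nonneg_right (hA2 _ _) (aux_nonneg hW0 hy h0 k i)
      _ ≤ _ := aux_term hW0 hy h0 k i i

theorem aux_window {n : ℕ} {W : ℕ → Fin n → Fin n → ℝ} {t0 : ℕ} {y : ℕ → Fin n → ℝ}
    (hW0 : ∀ t i j, 0 ≤ W t i j) {η : ℝ} (hη0 : 0 < η) (hη1 : η < 1) (hA2 : ∀ t i, η ≤ W t i i)
    (hy : DTraj n W t0 y) (h0 : ∀ i, 0 ≤ y t0 i) {a : ℝ} (ha : 0 < a) {T : ℕ} (hT : 1 ≤ T)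
    (i j : Fin n) (hs : a ≤ ∑ s ∈ Finset.Ico t0 (t0 + T), W s i j) :
    η ^ T * min 1 (a / T) * y t0 j ≤ y (t0 + T) i := by
  have hT' : (0 : ℝ) < T := by exact_mod_cast hT
  obtain ⟨s, hs1, hs2⟩ : ∃ s ∈ Finset.Ico t0 (t0 + T), a / T ≤ W s i j := by
    apply Finset.exists_le_of_sum_le (f := fun _ => a / T)
    · exact ⟨t0, by simp; omega⟩
    · simp only [Finset.sum_const, Nat.card_Ico, nsmul_eq_mul, add_tsub_cancel_left]
      rw [mul_div_cancel₀ _ hT'.ne']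
      exact hs
  rw [Finset.mem_Ico] at hs1
  obtain ⟨k, rfl⟩ := Nat.exists_eq_add_of_le hs1.1
  obtain ⟨l, hl⟩ : ∃ l, T = k + 1 + l := ⟨T - (k+1), by omega⟩
  have h1 := aux_self hW0 hη0 hA2 hy h0 k j
  have h2 := aux_term hW0 hy h0 k i j
  have hn := aux_nonneg hW0 hy h0
  have h3 := aux_self hW0 hη0 hA2 (aux_mono (t1 := t0 + k + 1) (by omega) hy)
    (fun i => hn (k+1) i) l i
  have e : t0 + T = t0 + k + 1 + l := by omega
  rw [e]
  have hb : min 1 (a / T) ≤ W (t0 + k) i j := (min_le_right _ _).trans hs2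
  have hb0 : 0 ≤ min 1 (a / T) := le_min zero_le_one (by positivity)
  have hy0 := h0 j
  calc η ^ T * min 1 (a / T) * y t0 j
      = η * (η ^ l * (min 1 (a/T) * (η ^ k * y t0 j))) := by
        have : η ^ T = η ^ k * η * η ^ l := by rw [hl]; ring
        rw [this]; ring
    _ ≤ 1 * (η ^ l * (min 1 (a/T) * (η ^ k * y t0 j))) := by gcongr
    _ = η ^ l * (min 1 (a/T) * (η ^ k * y t0 j)) := one_mul _
    _ ≤ η ^ l * (W (t0 + k) i j * y (t0 + k) j) := by
        have := hW0 (t0 + k) i j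
        gcongr
    _ ≤ η ^ l * y (t0 + k + 1) i := by gcongr
    _ ≤ _ := h3

theorem aux_path {n : ℕ} {W : ℕ → Fin n → Fin n → ℝ}
    (hW0 : ∀ t i j, 0 ≤ W t i j) {η : ℝ} (hη0 : 0 < η) (hη1 : η < 1) (hA2 : ∀ t i, η ≤ W t i i)
    {a : ℝ} (ha : 0 < a) {T : ℕ} (hT : 1 ≤ T)
    (hs : ∀ t : ℕ, ∀ j i : Fin n, DPersistent n W j i →
      a ≤ ∑ s ∈ Finset.Ico t (t + T), W s i j) {y : ℕ → Fin n → ℝ} (k : ℕ) :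
    ∀ (t0 : ℕ) (c v : Fin n), ReachIn (DPersistent n W) k c v → DTraj n W t0 y →
      (∀ i, 0 ≤ y t0 i) → (η ^ T * min 1 (a / T)) ^ k * y t0 c ≤ y (t0 + k * T) v := by
  have hb0 : 0 ≤ min 1 (a / T) := le_min zero_le_one (by positivity)
  induction k with
  | zero =>
    intro t0 c v h _ _
    have : c = v := h
    simp [this]
  | succ k ih =>
    rintro t0 c v ⟨m, h1, h2⟩ hy h0
    have h3 := aux_window hW0 hη0 hη1 hA2 hy h0 ha hT m c (hs t0 c m h1)
    have h4 := ih (t0 + T) m v h2 (aux_mono (by omega) hy) (fun i => aux_nonneg hW0 hy h0 T i)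
    have e : t0 + (k+1) * T = t0 + T + k * T := by ring
    rw [e]
    refine le_trans ?_ h4
    rw [pow_succ, mul_assoc]
    gcongr

theorem aux_suff (n : ℕ) (hn : 2 ≤ n) (W : ℕ → Fin n → Fin n → ℝ)
    (hW0 : ∀ t i j, 0 ≤ W t i j)
    (hA1 : ∀ t i, ∑ j, W t i j = 1)
    (η : ℝ) (hη0 : 0 < η) (hη1 : η < 1)
    (hA2 : ∀ t i, η ≤ W t i i) (hq : DQSC n W) (hc : DArcCond n W) : DEpsAgree n W := by
  haveI : NeZero n := ⟨by omega⟩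
  obtain ⟨c, hcc⟩ := hq
  obtain ⟨a, ha, T, hT, hs⟩ := hc
  choose d hd using hcc
  set g := η ^ T * min 1 (a / T) with hg
  have hT' : (0 : ℝ) < T := by exact_mod_cast hT
  have hm0 : 0 < min 1 (a / T) := lt_min zero_lt_one (by positivity)
  have hg0 : 0 < g := by positivity
  have hη2 : η ^ T < 1 := pow_lt_one₀ hη0.le hη1 (by omega)
  have hgη : g ≤ η ^ T := mul_le_of_le_one_right (by positivity) (min_le_left _ _)
  have hg1 : g < 1 := hgη.trans_lt hη2
  set K := (∑ v, d v) + 1 with hK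
  have hdK : ∀ v, d v ≤ K := fun v =>
    (Finset.single_le_sum (f := d) (fun _ _ => Nat.zero_le _) (Finset.mem_univ v)).trans (by omega)
  have key : ∀ (y : ℕ → Fin n → ℝ) (t0 : ℕ), DTraj n W t0 y → (∀ i, 0 ≤ y t0 i) →
      ∀ v, g ^ K * y t0 c ≤ y (t0 + K * T) v := by
    intro y t0 hy h0 v
    have h1 := aux_path hW0 hη0 hη1 hA2 ha hT hs (d v) t0 c v (hd v) hy h0
    obtain ⟨l, hl⟩ := Nat.exists_eq_add_of_le (hdK v)
    have h2 := aux_self hW0 hη0 hA2 (aux_mono (t1 := t0 + d v * T) (by omega) hy)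
      (fun i => aux_nonneg hW0 hy h0 _ i) (l * T) v
    have e : t0 + K * T = t0 + d v * T + l * T := by rw [hl]; ring
    rw [e]
    refine le_trans ?_ h2
    have h3 : g ^ l ≤ η ^ (l * T) := by
      rw [mul_comm l T, pow_mul]; gcongr
    have := h0 c
    calc g ^ K * y t0 c = g ^ l * (g ^ d v * y t0 c) := by rw [hl]; ring
      _ ≤ _ := by gcongr
  have hβ0 : 0 < g ^ K := by positivity
  have hβ1 : g ^ K < 1 := pow_lt_one₀ hg0.le hg1 (by omega)
  refine ⟨1 - g ^ K, by linarith, by linarith, K * T, Nat.mul_pos (by omega) (by omega), ?_⟩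
  intro t0 x hx t ht
  have hx' := aux_mono ht hx
  have hM : ∀ i, x t i ≤ dMax n x t := fun i => le_ciSup (f := fun i => x t i) (Set.finite_range _).bddAbove i
  have hm : ∀ i, dMin n x t ≤ x t i := fun i => ciInf_le (f := fun i => x t i) (Set.finite_range _).bddBelow i
  have k1 := key _ t (aux_shift hA1 hx' 1 (-dMin n x t)) (fun i => by linarith [hm i])
  have k2 := key _ t (aux_shift hA1 hx' (-1) (dMax n x t)) (fun i => by linarith [hM i])
  have u1 : dMax n x (t + K * T) ≤ dMax n x t - g ^ K * (dMax n x t - x t c) := by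
    apply ciSup_le
    intro i
    have := k2 i
    nlinarith
  have u2 : dMin n x t + g ^ K * (x t c - dMin n x t) ≤ dMin n x (t + K * T) := by
    apply le_ciInf
    intro i
    have := k1 i
    nlinarith
  unfold dH
  nlinarith

theorem aux_exists (n : ℕ) (W : ℕ → Fin n → Fin n → ℝ) (t0 : ℕ) (x0 : Fin n → ℝ) :
    ∃ x, DTraj n W t0 x ∧ x t0 = x0 := by
  let z : ℕ → Fin n → ℝ := fun k => Nat.rec x0 (fun k y i => ∑ j, W (t0 + k) i j * y j) k
  refine ⟨fun t => z (t - t0), ?_, by simp [z]⟩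
  intro t ht i
  obtain ⟨k, rfl⟩ := Nat.exists_eq_add_of_le ht
  have e1 : t0 + k + 1 - t0 = k + 1 := by omega
  have e2 : t0 + k - t0 = k := by omega
  simp only [e1, e2]
  rfl

/-- Upper growth estimate on an almost isolated set. -/
theorem aux_up {n : ℕ} {W : ℕ → Fin n → Fin n → ℝ} {t0 : ℕ} {y : ℕ → Fin n → ℝ}
    (hW0 : ∀ t i j, 0 ≤ W t i j) (hA1 : ∀ t i, ∑ j, W t i j = 1)
    (hy : DTraj n W t0 y) (h1 : ∀ i, y t0 i ≤ 1)
    (S : Fin n → Prop) [DecidablePred S] (e : ℕ → ℝ) (he0 : ∀ s, 0 ≤ e s)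
    (he : ∀ s i, S i → ∑ j, (if S j then 0 else W s i j) ≤ e s)
    (hS : ∀ i, S i → y t0 i ≤ 0) (k : ℕ) :
    ∀ i, S i → y (t0 + k) i ≤ ∑ s ∈ Finset.range k, e (t0 + s) := by
  have hle : ∀ k i, y (t0 + k) i ≤ 1 := by
    intro k i
    have := aux_nonneg hW0 (aux_shift hA1 hy (-1) 1) (fun i => by linarith [h1 i]) k i
    linarith
  induction k with
  | zero => simpa using hS
  | succ k ih =>
    intro i hi
    rw [← add_assoc, hy (t0 + k) (by omega) i, Finset.sum_range_succ]
    set E := ∑ s ∈ Finset.range k, e (t0 + s)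
    have hE : 0 ≤ E := Finset.sum_nonneg fun s _ => he0 _
    calc ∑ j, W (t0 + k) i j * y (t0 + k) j
        ≤ ∑ j, (W (t0 + k) i j * E + (if S j then 0 else W (t0 + k) i j)) := by
          apply Finset.sum_le_sum
          intro j _
          have hw := hW0 (t0 + k) i j
          split_ifs with hj
          · have := mul_le_mul_of_nonneg_left (ih j hj) hw
            linarith
          · have := mul_le_mul_of_nonneg_left (hle k j) hw
            have := mul_nonneg hw hE
            linarith
      _ ≤ E + e (t0 + k) := by
          rw [Finset.sum_add_distrib, ← Finset.sum_mul, hA1, one_mul]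
          have := he (t0 + k) i hi
          linarith

theorem aux_low {n : ℕ} {W : ℕ → Fin n → Fin n → ℝ}
    (hW0 : ∀ t i j, 0 ≤ W t i j) (hA1 : ∀ t i, ∑ j, W t i j = 1)
    (S1 S2 : Fin n → Prop) [DecidablePred S1] [DecidablePred S2] (hd : ∀ i, S1 i → ¬ S2 i)
    (u v : Fin n) (hu : S1 u) (hv : S2 v) (e : ℕ → ℝ) (he0 : ∀ s, 0 ≤ e s)
    (he1 : ∀ s i, S1 i → ∑ j, (if S1 j then 0 else W s i j) ≤ e s)
    (he2 : ∀ s i, S2 i → ∑ j, (if S2 j then 0 else W s i j) ≤ e s)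
    {ε : ℝ} (hε : 0 < ε) {T0 : ℕ}
    (hag : ∀ t0 : ℕ, ∀ x : ℕ → Fin n → ℝ, DTraj n W t0 x →
      ∀ t, t0 ≤ t → dH n x (t + T0) ≤ ε * dH n x t) (t0 m : ℕ) :
    1 - 2 * ∑ s ∈ Finset.range (m * T0), e (t0 + s) ≤ ε ^ m := by
  haveI : Nonempty (Fin n) := ⟨u⟩
  obtain ⟨x, hx, hx0⟩ := aux_exists n W t0 (fun i => if S1 i then 1 else 0)
  have b1 : ∀ i, x t0 i ≤ 1 := by intro i; rw [hx0]; simp only; split_ifs <;> norm_num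
  have b0 : ∀ i, 0 ≤ x t0 i := by intro i; rw [hx0]; simp only; split_ifs <;> norm_num
  have p2 := aux_up hW0 hA1 hx b1 S2 e he0 he2
    (fun i hi => by rw [hx0]; simp only; rw [if_neg (fun h => hd i h hi)]) (m * T0) v hv
  have p1 := aux_up hW0 hA1 (aux_shift hA1 hx (-1) 1) (fun i => by linarith [b0 i]) S1 e he0 he1
    (fun i hi => by rw [hx0]; simp only; rw [if_pos hi]; norm_num) (m * T0) u hu
  have hH : dH n x t0 ≤ 1 := by
    have h1 : dMax n x t0 ≤ 1 := ciSup_le b1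
    have h2 : 0 ≤ dMin n x t0 := le_ciInf b0
    unfold dH; linarith
  have hp : ∀ m, dH n x (t0 + m * T0) ≤ ε ^ m := by
    intro m
    induction m with
    | zero => simpa using hH
    | succ m ih =>
      have := hag t0 x hx (t0 + m * T0) (by omega)
      have e : t0 + (m+1) * T0 = t0 + m * T0 + T0 := by ring
      rw [e, pow_succ']
      exact this.trans (by gcongr)
  have h3 := hp m
  have hM : x (t0 + m * T0) u ≤ dMax n x (t0 + m * T0) :=
    le_ciSup (f := fun i => x (t0 + m * T0) i) (Set.finite_range _).bddAbove u
  have hm : dMin n x (t0 + m * T0) ≤ x (t0 + m * T0) v :=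
    ciInf_le (f := fun i => x (t0 + m * T0) i) (Set.finite_range _).bddBelow v
  unfold dH at h3
  linarith

open Classical in
/-- Total weight of the non-persistent arcs. -/
noncomputable def auxN (n : ℕ) (W : ℕ → Fin n → Fin n → ℝ) (s : ℕ) : ℝ :=
  ∑ i, ∑ j, if j ≠ i ∧ ¬ DPersistent n W j i then W s i j else 0

theorem auxN_nonneg {n : ℕ} {W : ℕ → Fin n → Fin n → ℝ}
    (hW0 : ∀ t i j, 0 ≤ W t i j) (s : ℕ) : 0 ≤ auxN n W s := by
  unfold auxN
  refine Finset.sum_nonneg fun i _ => Finset.sum_nonneg fun j _ => ?_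
  split_ifs
  · exact hW0 _ _ _
  · exact le_rfl

theorem auxN_row {n : ℕ} {W : ℕ → Fin n → Fin n → ℝ}
    (hW0 : ∀ t i j, 0 ≤ W t i j) (s : ℕ) (i : Fin n) (f : Fin n → ℝ)
    (hf : ∀ j, f j ≤ (open Classical in if j ≠ i ∧ ¬ DPersistent n W j i then W s i j else 0)) :
    ∑ j, f j ≤ auxN n W s := by
  classical
  unfold auxN
  refine (Finset.sum_le_sum fun j _ => hf j).trans ?_
  refine Finset.single_le_sum
    (f := fun i => ∑ j, if j ≠ i ∧ ¬ DPersistent n W j i then W s i j else 0) ?_ (Finset.mem_univ i)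
  refine fun i _ => Finset.sum_nonneg fun j _ => ?_
  split_ifs
  · exact hW0 _ _ _
  · exact le_rfl

theorem auxN_tail {n : ℕ} {W : ℕ → Fin n → Fin n → ℝ}
    (hW0 : ∀ t i j, 0 ≤ W t i j) {δ : ℝ} (hδ : 0 < δ) :
    ∃ t1, ∀ t, t1 ≤ t → ∀ k, ∑ s ∈ Finset.range k, auxN n W (t + s) ≤ δ := by
  classical
  have hsum : Summable (auxN n W) := by
    unfold auxN
    refine summable_sum fun i _ => summable_sum fun j _ => ?_
    by_cases h : j ≠ i ∧ ¬ DPersistent n W j i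
    · simp only [h, if_true]
      by_contra hns
      have h2 : ¬ Summable (fun s => W s i j) := by
        intro h3; apply hns; simpa [h.1] using h3
      rw [not_summable_iff_tendsto_nat_atTop_of_nonneg (fun s => hW0 s i j)] at h2
      exact h.2 ⟨h.1, h2⟩
    · simp only [h, if_false]
      exact summable_zero
  have ht := (tendsto_sum_nat_add (auxN n W)).eventually (gt_mem_nhds hδ)
  obtain ⟨t1, h1⟩ := Filter.eventually_atTop.1 ht
  refine ⟨t1, fun t ht k => ?_⟩
  have hs' : Summable (fun s => auxN n W (s + t)) := (summable_nat_add_iff t).2 hsum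
  have := hs'.sum_le_tsum (Finset.range k) (fun s _ => auxN_nonneg hW0 _)
  refine le_trans ?_ (this.trans (h1 t ht).le)
  exact Finset.sum_le_sum fun s _ => by rw [add_comm]

theorem aux_reach {α : Type*} {R : α → α → Prop} {a b : α} (h : Relation.ReflTransGen R a b) :
    ∃ k, ReachIn R k a b := by
  induction h using Relation.ReflTransGen.head_induction_on with
  | refl => exact ⟨0, rfl⟩
  | head h _ ih =>
    obtain ⟨k, hk⟩ := ih
    exact ⟨k + 1, _, h, hk⟩

theorem aux_nec_a (n : ℕ) (hn : 2 ≤ n) (W : ℕ → Fin n → Fin n → ℝ)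
    (hW0 : ∀ t i j, 0 ≤ W t i j)
    (hA1 : ∀ t i, ∑ j, W t i j = 1) (h : DEpsAgree n W) : DQSC n W := by
  classical
  haveI : NeZero n := ⟨by omega⟩
  obtain ⟨ε, hε0, hε1, T0, hT0, hag⟩ := h
  set P := DPersistent n W with hP
  by_contra hq
  have : ∃ u v, ∀ c, Relation.ReflTransGen P c u → ¬ Relation.ReflTransGen P c v := by
    by_contra! hcon
    apply hq
    have hdir : Directed (fun a b => Relation.ReflTransGen P b a) (id : Fin n → Fin n) := by
      intro u v
      obtain ⟨c, h1, h2⟩ := hcon u v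
      exact ⟨c, h1, h2⟩
    haveI : IsTrans (Fin n) (fun a b => Relation.ReflTransGen P b a) :=
      ⟨fun a b c h1 h2 => h2.trans h1⟩
    obtain ⟨c, hc⟩ := hdir.finite_le
      (id : Fin n → Fin n)
    exact ⟨c, fun v => aux_reach (hc v)⟩
  obtain ⟨u, v, huv⟩ := this
  obtain ⟨t1, ht1⟩ := auxN_tail hW0 (δ := 1/8) (by norm_num)
  obtain ⟨m, hm⟩ := exists_pow_lt_of_lt_one (show (0:ℝ) < 1/2 by norm_num) hε1
  have hrow : ∀ w s i, Relation.ReflTransGen P i w →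
      ∑ j, (if Relation.ReflTransGen P j w then 0 else W s i j) ≤ auxN n W s := by
    intro w s i hi
    apply auxN_row hW0 s i
    intro j
    by_cases hj : Relation.ReflTransGen P j w
    · rw [if_pos hj]
      split_ifs
      · exact hW0 _ _ _
      · exact le_rfl
    · rw [if_neg hj, if_pos]
      refine ⟨fun h => hj (h ▸ hi), fun h => hj (Relation.ReflTransGen.head h hi)⟩
  have := aux_low hW0 hA1 (fun i => Relation.ReflTransGen P i u)
    (fun i => Relation.ReflTransGen P i v) huv u v Relation.ReflTransGen.refl
    Relation.ReflTransGen.refl (auxN n W) (auxN_nonneg hW0) (hrow u) (hrow v) hε0 hag t1 m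
  have := ht1 t1 le_rfl (m * T0)
  linarith

theorem aux_nec_b (n : ℕ) (hn : 2 ≤ n) (W : ℕ → Fin n → Fin n → ℝ)
    (hW0 : ∀ t i j, 0 ≤ W t i j)
    (hA1 : ∀ t i, ∑ j, W t i j = 1)
    (A : ℝ) (hA : 1 < A)
    (hA3 : ∀ t : ℕ, ∀ i j k m : Fin n, DPersistent n W j i → DPersistent n W m k →
      A⁻¹ * W t i j ≤ W t k m ∧ W t k m ≤ A * W t i j)
    (h : DEpsAgree n W) : DArcCond n W := by
  classical
  obtain ⟨ε, hε0, hε1, T0, hT0, hag⟩ := h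
  obtain ⟨t1, ht1⟩ := auxN_tail hW0 (δ := (1 - ε) / 4) (by linarith)
  have hn' : (0:ℝ) < n := by exact_mod_cast (by omega : 0 < n)
  refine ⟨(1 - ε) / (4 * (n * A)), by apply div_pos <;> [linarith; positivity], t1 + T0, by omega, ?_⟩
  intro t j i hji
  have hrow : ∀ w s i', i' = w →
      ∑ j', (if j' = w then 0 else W s i' j') ≤ auxN n W s + n * A * W s i j := by
    intro w s i' hi'
    subst hi'
    have h1 : ∑ j', ((if j' = i' then 0 else W s i' j') - A * W s i j) ≤ auxN n W s := by
      apply auxN_row hW0 s i'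
      intro j'
      have hw : 0 ≤ A * W s i j := mul_nonneg (by linarith) (hW0 _ _ _)
      by_cases h1 : j' = i'
      · simp [h1, hw]
      · by_cases h2 : DPersistent n W j' i'
        · have := (hA3 s i j i' j' hji h2).2
          simp [h1, h2, this]
        · simp [h1, h2, hw]
    rw [Finset.sum_sub_distrib] at h1
    simp only [Finset.sum_const, Finset.card_univ, Fintype.card_fin, nsmul_eq_mul] at h1
    linarith
  have key := aux_low hW0 hA1 (fun i' => i' = i) (fun i' => i' = j)
    (by rintro a rfl hb; exact hji.1 hb.symm) i j rfl rfl
    (fun s => auxN n W s + n * A * W s i j)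
    (fun s => add_nonneg (auxN_nonneg hW0 s) (mul_nonneg (mul_nonneg hn'.le (by linarith)) (hW0 _ _ _)))
    (hrow i) (hrow j) hε0 hag (t + t1) 1
  rw [pow_one, one_mul, Finset.sum_add_distrib, ← Finset.mul_sum] at key
  have h2 := ht1 (t + t1) (by omega) T0
  have h3 : ∑ s ∈ Finset.range T0, W (t + t1 + s) i j ≤
      ∑ s ∈ Finset.Ico t (t + (t1 + T0)), W s i j := by
    have e : ∑ s ∈ Finset.range T0, W (t + t1 + s) i j
        = ∑ s ∈ Finset.Ico (t + t1) (t + t1 + T0), W s i j := by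
      rw [Finset.sum_Ico_eq_sum_range]; simp
    rw [e]
    apply Finset.sum_le_sum_of_subset_of_nonneg
    · apply Finset.Ico_subset_Ico <;> omega
    · intros; exact hW0 _ _ _
  refine le_trans ?_ h3
  rw [div_le_iff₀ (by positivity)]
  linarith


/-- Under A1, A2, A3, global ε-agreement holds iff the persistent graph is
quasi-strongly connected and condition (b) holds. -/
theorem discrete_eps_agreement_iff
    (n : ℕ) (hn : 2 ≤ n) (W : ℕ → Fin n → Fin n → ℝ)
    (hW0 : ∀ t i j, 0 ≤ W t i j)
    (hA1 : ∀ t i, ∑ j, W t i j = 1)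
    (η : ℝ) (hη0 : 0 < η) (hη1 : η < 1)
    (hA2 : ∀ t i, η ≤ W t i i)
    (A : ℝ) (hA : 1 < A)
    (hA3 : ∀ t : ℕ, ∀ i j k m : Fin n, DPersistent n W j i → DPersistent n W m k →
      A⁻¹ * W t i j ≤ W t k m ∧ W t k m ≤ A * W t i j) :
    DEpsAgree n W ↔ (DQSC n W ∧ DArcCond n W) := by
  exact ⟨fun h => ⟨aux_nec_a n hn W hW0 hA1 h, aux_nec_b n hn W hW0 hA1 A hA hA3 h⟩,
    fun h => aux_suff n hn W hW0 hA1 η hη0 hη1 hA2 h.1 h.2⟩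
end

section
/- Under assumption A1 (stochasticity), if the discrete-time belief evolution achieves global agreement, then the persistent graph G^p is quasi-strongly connected. -/
open Filter Finset

lemma reachIn_trans {α : Type*} {R : α → α → Prop} : ∀ (k l : ℕ) (a b c : α),
    ReachIn R k a b → ReachIn R l b c → ReachIn R (k + l) a c := by
  intro k
  induction k with
  | zero => intro l a b c h1 h2; simp only [ReachIn] at h1; subst h1; simpa using h2
  | succ k ih =>
    intro l a b c h1 h2
    obtain ⟨m, hm, h1⟩ := h1
    rw [Nat.add_right_comm]
    exact ⟨m, hm, ih l m b c h1 h2⟩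

lemma exists_disjoint {n : ℕ} (hn : 2 ≤ n) (R : Fin n → Fin n → Prop)
    (h : ¬ ∃ c : Fin n, ∀ v, ∃ k, ReachIn R k c v) :
    ∃ c v : Fin n, ∀ u, (∃ k, ReachIn R k u c) → (∃ k, ReachIn R k u v) → False := by
  classical
  by_contra! hcon
  apply h
  haveI : Nonempty (Fin n) := ⟨⟨0, by omega⟩⟩
  obtain ⟨c, hc⟩ := Finite.exists_max
    (fun c : Fin n => (univ.filter (fun v => ∃ k, ReachIn R k c v)).card)
  refine ⟨c, fun v => ?_⟩
  by_contra hv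
  obtain ⟨u, ⟨k, hk⟩, ⟨l, hl⟩, -⟩ := hcon c v
  have hlt : (univ.filter (fun v => ∃ k, ReachIn R k c v)).card <
      (univ.filter (fun v => ∃ k, ReachIn R k u v)).card := by
    apply Finset.card_lt_card
    refine (Finset.ssubset_iff_of_subset ?_).2 ⟨v, by simpa using ⟨l, hl⟩, by simpa using hv⟩
    intro w hw
    simp only [Finset.mem_filter, Finset.mem_univ, true_and] at hw ⊢
    obtain ⟨m, hm⟩ := hw
    exact ⟨_, reachIn_trans _ _ _ _ _ hk hm⟩
  exact absurd (hc u) (by simpa using hlt)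

lemma traj_le_one {n : ℕ} (W : ℕ → Fin n → Fin n → ℝ)
    (hW0 : ∀ t i j, 0 ≤ W t i j) (hA1 : ∀ t i, ∑ j, W t i j = 1)
    (t0 : ℕ) (x : ℕ → Fin n → ℝ) (hx : DTraj n W t0 x) (h0 : ∀ i, x t0 i ≤ 1) (k : ℕ) :
    ∀ i, x (t0 + k) i ≤ 1 := by
  induction k with
  | zero => simpa using h0
  | succ k ih =>
    intro i
    rw [← Nat.add_assoc, hx _ (by omega), ← hA1 (t0 + k) i]
    exact Finset.sum_le_sum fun j _ => by nlinarith [hW0 (t0 + k) i j, ih j]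

lemma traj_small {n : ℕ} (W : ℕ → Fin n → Fin n → ℝ)
    (hW0 : ∀ t i j, 0 ≤ W t i j) (hA1 : ∀ t i, ∑ j, W t i j = 1)
    (t0 : ℕ) (x : ℕ → Fin n → ℝ) (hx : DTraj n W t0 x) (h1 : ∀ i, x t0 i ≤ 1)
    (C : Fin n → Prop) [DecidablePred C] (e : ℕ → ℝ) (he0 : ∀ t, 0 ≤ e t)
    (he : ∀ t i, C i → ∑ j, (if C j then 0 else W t i j) ≤ e t)
    (h0 : ∀ i, C i → x t0 i ≤ 0) (k : ℕ) :
    ∀ i, C i → x (t0 + k) i ≤ ∑ s ∈ range k, e (s + t0) := by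
  induction k with
  | zero => simpa using h0
  | succ k ih =>
    intro i hi
    have hS : 0 ≤ ∑ s ∈ range k, e (s + t0) := Finset.sum_nonneg fun _ _ => he0 _
    rw [← Nat.add_assoc, hx _ (by omega), Finset.sum_range_succ]
    set S := ∑ s ∈ range k, e (s + t0)
    have h2 := he (t0 + k) i hi
    have h3 : ∑ j, W (t0 + k) i j * x (t0 + k) j ≤
        ∑ j, (W (t0 + k) i j * S + (if C j then 0 else W (t0 + k) i j)) := by
      apply Finset.sum_le_sum
      intro j _
      have hw := hW0 (t0 + k) i j
      split_ifs with hj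
      · nlinarith [ih j hj]
      · nlinarith [traj_le_one W hW0 hA1 t0 x hx h1 k j, mul_nonneg hw hS]
    rw [Finset.sum_add_distrib, ← Finset.sum_mul, hA1, one_mul] at h3
    rw [Nat.add_comm k t0]
    linarith

lemma anc_summable {n : ℕ} (W : ℕ → Fin n → Fin n → ℝ)
    (hW0 : ∀ t i j, 0 ≤ W t i j) (C : Fin n → Prop) [DecidablePred C]
    (hC : ∀ i j, C i → DPersistent n W j i → C j) :
    ∃ e : ℕ → ℝ, (∀ t, 0 ≤ e t) ∧ Summable e ∧
      (∀ t i, C i → ∑ j, (if C j then 0 else W t i j) ≤ e t) := by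
  have hnn : ∀ t i, 0 ≤ ∑ j, (if C j then 0 else W t i j) := fun t i =>
    Finset.sum_nonneg fun j _ => by split_ifs; exacts [le_rfl, hW0 t i j]
  have hnn2 : ∀ t, ∀ i ∈ (univ : Finset (Fin n)),
      0 ≤ if C i then ∑ j, (if C j then 0 else W t i j) else 0 := fun t i _ => by
    split_ifs; exacts [hnn t i, le_rfl]
  refine ⟨fun t => ∑ i, if C i then ∑ j, (if C j then 0 else W t i j) else 0,
    fun t => Finset.sum_nonneg (hnn2 t), ?_, ?_⟩
  · apply summable_sum
    intro i _
    by_cases hi : C i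
    · simp only [hi, if_true]
      apply summable_sum
      intro j _
      by_cases hj : C j
      · simpa [hj] using summable_zero
      · simp only [hj, if_false]
        by_contra hs
        rw [not_summable_iff_tendsto_nat_atTop_of_nonneg (fun t => hW0 t i j)] at hs
        exact hj (hC i j hi ⟨fun h => hj (h ▸ hi), hs⟩)
    · simpa [hi] using summable_zero
  · intro t i hi
    have := Finset.single_le_sum (hnn2 t) (Finset.mem_univ i)
    simpa [hi] using this

lemma tail_small (e : ℕ → ℝ) (he0 : ∀ t, 0 ≤ e t) (hs : Summable e) :
    ∀ᶠ t0 in atTop, ∀ k, ∑ s ∈ range k, e (s + t0) < 1 / 4 := by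
  have h := tendsto_sum_nat_add e
  filter_upwards [h.eventually (gt_mem_nhds (show (0 : ℝ) < 1 / 4 by norm_num))] with t0 ht k
  exact lt_of_le_of_lt (((summable_nat_add_iff t0).2 hs).sum_le_tsum _ fun _ _ => he0 _) ht

theorem discrete_agreement_implies_qsc
    (n : ℕ) (hn : 2 ≤ n) (W : ℕ → Fin n → Fin n → ℝ)
    (hW0 : ∀ t i j, 0 ≤ W t i j)
    (hA1 : ∀ t i, ∑ j, W t i j = 1)
    (hagree : DAgree n W) :
    DQSC n W := by
  classical
  by_contra hq
  obtain ⟨a, b, hab⟩ := exists_disjoint hn _ hq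
  have hanc : ∀ c i j : Fin n, (∃ k, ReachIn (DPersistent n W) k i c) → DPersistent n W j i →
      ∃ k, ReachIn (DPersistent n W) k j c := by
    rintro c i j ⟨k, hk⟩ h
    exact ⟨k + 1, i, h, hk⟩
  obtain ⟨e, he0, hes, he⟩ := anc_summable W hW0 _ (hanc a)
  obtain ⟨f, hf0, hfs, hf⟩ := anc_summable W hW0 _ (hanc b)
  obtain ⟨t0, het, hft⟩ := ((tail_small e he0 hes).and (tail_small f hf0 hfs)).exists
  let x0 : Fin n → ℝ := fun i => if ∃ k, ReachIn (DPersistent n W) k i a then 1 else 0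
  let X : ℕ → Fin n → ℝ := fun k =>
    Nat.rec x0 (fun k y i => ∑ j, W (t0 + k) i j * y j) k
  let x : ℕ → Fin n → ℝ := fun t => X (t - t0)
  have hx : DTraj n W t0 x := by
    intro t ht i
    obtain ⟨k, rfl⟩ := Nat.exists_eq_add_of_le ht
    have h1 : t0 + k + 1 - t0 = k + 1 := by omega
    have h2 : t0 + k - t0 = k := by omega
    simp only [x, h1, h2]
    rfl
  have hxt : x t0 = x0 := by simp [x, X]
  have hy : DTraj n W t0 (fun t i => 1 - x t i) := by
    intro t ht i
    simp only [mul_sub, mul_one, Finset.sum_sub_distrib, hA1, hx t ht i]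
  have hB := traj_small W hW0 hA1 t0 x hx
    (by intro i; rw [hxt]; simp only [x0]; split_ifs <;> norm_num)
    _ f hf0 hf (by
      intro i hi; rw [hxt]; simp only [x0]
      rw [if_neg (fun h => hab i h hi)])
  have hA := traj_small W hW0 hA1 t0 _ hy
    (by intro i; simp only [hxt, x0]; split_ifs <;> norm_num)
    _ e he0 he (by intro i hi; simp only [hxt, x0]; rw [if_pos hi]; norm_num)
  have hH : ∀ k, 1 / 2 ≤ dH n x (t0 + k) := by
    intro k
    have h1 := hA k a ⟨0, rfl⟩
    have h2 := hB k b ⟨0, rfl⟩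
    have h3 : x (t0 + k) a ≤ dMax n x (t0 + k) :=
      le_ciSup (f := x (t0 + k)) (Set.finite_range _).bddAbove a
    have h4 : dMin n x (t0 + k) ≤ x (t0 + k) b :=
      ciInf_le (f := x (t0 + k)) (Set.finite_range _).bddBelow b
    have := het k
    have := hft k
    unfold dH
    linarith
  have hlim := hagree t0 x hx
  obtain ⟨T, hT⟩ := (hlim.eventually (gt_mem_nhds (show (0 : ℝ) < 1 / 2 by norm_num))).exists_forall_of_atTop
  have := hT (t0 + T) (by omega)
  linarith [hH T]
end

section
/- Under assumption A1 (stochasticity), suppose a trajectory of the discrete-time belief evolution satisfies x_m(t) = μ ψ(t) + (1−μ) Ψ(t) for some node m, some time t, and some constant μ ∈ [0,1]. Then for every integer T ≥ 1, x_m(t+T) ≤ μ ∏_{s=t}^{t+T-1}(1 − ξ⁺(s;m)) · ψ(t) + (1 − μ ∏_{s=t}^{t+T-1}(1 − ξ⁺(s;m))) · Ψ(t). -/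
open Filter Finset

/-- Under A1, if x_m(t) = μψ(t) + (1−μ)Ψ(t), then for every T ≥ 1,
x_m(t+T) ≤ μ∏(1−ξ⁺)·ψ(t) + (1 − μ∏(1−ξ⁺))·Ψ(t). -/
theorem discrete_upper_bound_lemma
    (n : ℕ) (hn : 2 ≤ n) (W : ℕ → Fin n → Fin n → ℝ)
    (hW0 : ∀ t i j, 0 ≤ W t i j)
    (hA1 : ∀ t i, ∑ j, W t i j = 1)
    (t0 : ℕ) (x : ℕ → Fin n → ℝ) (hx : DTraj n W t0 x)
    (m : Fin n) (t : ℕ) (ht : t0 ≤ t)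
    (μ : ℝ) (hμ0 : 0 ≤ μ) (hμ1 : μ ≤ 1)
    (hxm : x t m = μ * dMin n x t + (1 - μ) * dMax n x t) :
    ∀ T : ℕ, 1 ≤ T →
      x (t + T) m ≤
        μ * (∏ s ∈ Finset.Ico t (t + T), (1 - dXi n W s m)) * dMin n x t
          + (1 - μ * ∏ s ∈ Finset.Ico t (t + T), (1 - dXi n W s m)) * dMax n x t := by
  have hmax : ∀ k i, x (t + k) i ≤ dMax n x t := by
    intro k
    induction k with
    | zero =>
      intro i
      exact le_ciSup (f := fun i => x t i) (Set.finite_range _).bddAbove i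
    | succ k ih =>
      intro i
      have h1 := hx (t + k) (by omega) i
      rw [← add_assoc, h1]
      calc ∑ j, W (t + k) i j * x (t + k) j
          ≤ ∑ j, W (t + k) i j * dMax n x t :=
            Finset.sum_le_sum fun j _ => mul_le_mul_of_nonneg_left (ih j) (hW0 _ _ _)
        _ = dMax n x t := by rw [← Finset.sum_mul, hA1, one_mul]
  have hxi : ∀ s, W s m m = 1 - dXi n W s m := by
    intro s
    have h1 := Finset.add_sum_erase Finset.univ (fun j => W s m j) (Finset.mem_univ m)
    have h2 := hA1 s m
    unfold dXi
    linarith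
  intro T _
  induction T with
  | zero => simp [hxm]
  | succ k ih =>
    have ih : x (t + k) m ≤
        μ * (∏ s ∈ Finset.Ico t (t + k), (1 - dXi n W s m)) * dMin n x t
          + (1 - μ * ∏ s ∈ Finset.Ico t (t + k), (1 - dXi n W s m)) * dMax n x t := by
      rcases Nat.eq_zero_or_pos k with h | h
      · subst h
        simp [hxm]
      · exact ih h
    rw [← add_assoc, Finset.prod_Ico_succ_top (by omega), hx (t + k) (by omega) m,
      ← Finset.add_sum_erase Finset.univ _ (Finset.mem_univ m), ← hxi (t + k)]
    have h1 : ∑ j ∈ Finset.univ.erase m, W (t + k) m j * x (t + k) j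
        ≤ dXi n W (t + k) m * dMax n x t := by
      unfold dXi
      rw [Finset.sum_mul]
      exact Finset.sum_le_sum fun j _ => mul_le_mul_of_nonneg_left (hmax k j) (hW0 _ _ _)
    have h2 := mul_le_mul_of_nonneg_left ih (hW0 (t + k) m m)
    have h3 : dXi n W (t + k) m = 1 - W (t + k) m m := by rw [hxi]; ring
    rw [h3] at h1
    refine (add_le_add h2 h1).trans (le_of_eq ?_)
    ring
end

section
/- Under assumption A1 (stochasticity), suppose a trajectory of the discrete-time belief evolution satisfies x_m(t) = μ Ψ(t) + (1−μ) ψ(t) for some node m, some time t, and some constant μ ∈ [0,1]. Then for every integer T ≥ 1, x_m(t+T) ≥ μ ∏_{s=t}^{t+T-1}(1 − ξ⁺(s;m)) · Ψ(t) + (1 − μ ∏_{s=t}^{t+T-1}(1 − ξ⁺(s;m))) · ψ(t). -/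
open Filter Finset

/-- Under A1, if x_m(t) = μΨ(t) + (1−μ)ψ(t), then for every T ≥ 1,
x_m(t+T) ≥ μ∏(1−ξ⁺)·Ψ(t) + (1 − μ∏(1−ξ⁺))·ψ(t). -/
theorem discrete_lower_bound_lemma
    (n : ℕ) (hn : 2 ≤ n) (W : ℕ → Fin n → Fin n → ℝ)
    (hW0 : ∀ t i j, 0 ≤ W t i j)
    (hA1 : ∀ t i, ∑ j, W t i j = 1)
    (t0 : ℕ) (x : ℕ → Fin n → ℝ) (hx : DTraj n W t0 x)
    (m : Fin n) (t : ℕ) (ht : t0 ≤ t)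
    (μ : ℝ) (hμ0 : 0 ≤ μ) (hμ1 : μ ≤ 1)
    (hxm : x t m = μ * dMax n x t + (1 - μ) * dMin n x t) :
    ∀ T : ℕ, 1 ≤ T →
      x (t + T) m ≥
        μ * (∏ s ∈ Finset.Ico t (t + T), (1 - dXi n W s m)) * dMax n x t
          + (1 - μ * ∏ s ∈ Finset.Ico t (t + T), (1 - dXi n W s m)) * dMin n x t := by
  have hmin : ∀ T j, dMin n x t ≤ x (t + T) j := by
    intro T
    induction T with
    | zero => intro j; exact ciInf_le (Set.finite_range _).bddBelow j
    | succ k ih =>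
      intro j
      rw [← add_assoc, hx (t + k) (by omega) j]
      calc dMin n x t = ∑ i, W (t + k) j i * dMin n x t := by
            rw [← Finset.sum_mul, hA1, one_mul]
        _ ≤ _ := Finset.sum_le_sum fun i _ =>
            mul_le_mul_of_nonneg_left (ih i) (hW0 _ _ _)
  intro T _
  induction T with
  | zero => simp [hxm]
  | succ k ih =>
    have ih : x (t + k) m ≥
        μ * (∏ s ∈ Finset.Ico t (t + k), (1 - dXi n W s m)) * dMax n x t
          + (1 - μ * ∏ s ∈ Finset.Ico t (t + k), (1 - dXi n W s m)) * dMin n x t := by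
      rcases Nat.eq_zero_or_pos k with h | h
      · subst h; simp [hxm]
      · exact ih h
    have hw : W (t + k) m m + dXi n W (t + k) m = 1 := by
      rw [← hA1 (t + k) m]
      exact Finset.add_sum_erase _ _ (Finset.mem_univ m)
    have hs : x (t + (k + 1)) m ≥
        W (t + k) m m * x (t + k) m + dXi n W (t + k) m * dMin n x t := by
      rw [← add_assoc, hx (t + k) (by omega) m,
        ← Finset.add_sum_erase _ _ (Finset.mem_univ m)]
      refine add_le_add le_rfl ?_
      rw [dXi, Finset.sum_mul]
      exact Finset.sum_le_sum fun i _ =>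
        mul_le_mul_of_nonneg_left (hmin k i) (hW0 _ _ _)
    rw [← add_assoc, Finset.prod_Ico_succ_top (by omega)]
    rw [← add_assoc] at hs
    have h1 := mul_le_mul_of_nonneg_left ih (hW0 (t + k) m m)
    have hd : dXi n W (t + k) m = 1 - W (t + k) m m := by linarith
    rw [hd] at hs ⊢
    refine le_trans (le_of_eq ?_) (le_trans (add_le_add h1 le_rfl) hs)
    ring
end

section
/- Under assumption A3 (arc balance with constant A > 1) and assuming solutions exist from every initial time and initial state, the continuous-time belief evolution achieves global agreement if and only if the persistent graph G^p is quasi-strongly connected. -/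
open Filter Finset MeasureTheory

/-- Regularity of the weight functions: nonnegative, measurable and locally integrable. -/
def CRegular (n : ℕ) (W : ℝ → Fin n → Fin n → ℝ) : Prop :=
  (∀ t i j, 0 ≤ W t i j) ∧ (∀ i j, Measurable fun t => W t i j) ∧
    (∀ i j, LocallyIntegrable (fun t => W t i j))

/-- A (Caratheodory) solution of the continuous-time belief evolution with initial time `t0`,
written in integral form. -/
def CSol (n : ℕ) (W : ℝ → Fin n → Fin n → ℝ) (t0 : ℝ) (x : ℝ → Fin n → ℝ) : Prop :=
  (∀ i, ContinuousOn (fun t => x t i) (Set.Ici t0)) ∧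
    ∀ i : Fin n, ∀ t : ℝ, t0 ≤ t →
      x t i = x t0 i + ∫ s in t0..t, ∑ j, W s i j * (x s j - x s i)

/-- Solutions exist from every initial time `t0 ≥ 0` and every initial state. -/
def CSolExists (n : ℕ) (W : ℝ → Fin n → Fin n → ℝ) : Prop :=
  ∀ t0 : ℝ, 0 ≤ t0 → ∀ x0 : Fin n → ℝ, ∃ x : ℝ → Fin n → ℝ,
    CSol n W t0 x ∧ ∀ i, x t0 i = x0 i

/-- Maximum state Ψ(t). -/
noncomputable def cMax (n : ℕ) (x : ℝ → Fin n → ℝ) (t : ℝ) : ℝ := ⨆ i, x t i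

/-- Minimum state ψ(t). -/
noncomputable def cMin (n : ℕ) (x : ℝ → Fin n → ℝ) (t : ℝ) : ℝ := ⨅ i, x t i

/-- Agreement measure H(t) = Ψ(t) − ψ(t). -/
noncomputable def cH (n : ℕ) (x : ℝ → Fin n → ℝ) (t : ℝ) : ℝ := cMax n x t - cMin n x t

/-- `(j,i)` is a persistent arc: `j ≠ i` and `∫_s^∞ W_ij(t) dt = ∞` for every `s ≥ 0`. -/
def CPersistent (n : ℕ) (W : ℝ → Fin n → Fin n → ℝ) (j i : Fin n) : Prop :=
  j ≠ i ∧ ∀ s : ℝ, 0 ≤ s → Tendsto (fun T => ∫ t in s..T, W t i j) atTop atTop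

/-- The persistent graph is quasi-strongly connected: it has a center. -/
def CQSC (n : ℕ) (W : ℝ → Fin n → Fin n → ℝ) : Prop :=
  ∃ c : Fin n, ∀ v : Fin n, ∃ k, ReachIn (CPersistent n W) k c v

/-- A3 (arc balance) with constant `A`. -/
def CArcBalance (n : ℕ) (W : ℝ → Fin n → Fin n → ℝ) (A : ℝ) : Prop :=
  ∀ t : ℝ, 0 ≤ t → ∀ i j k m : Fin n, CPersistent n W j i → CPersistent n W m k →
    A⁻¹ * W t i j ≤ W t k m ∧ W t k m ≤ A * W t i j

/-- Global agreement for the continuous-time evolution. -/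
def CAgree (n : ℕ) (W : ℝ → Fin n → Fin n → ℝ) : Prop :=
  ∀ t0 : ℝ, 0 ≤ t0 → ∀ x : ℝ → Fin n → ℝ, CSol n W t0 x →
    Tendsto (cH n x) atTop (nhds 0)

/-- Global ε-agreement for the continuous-time evolution. -/
def CEpsAgree (n : ℕ) (W : ℝ → Fin n → Fin n → ℝ) : Prop :=
  ∃ ε : ℝ, 0 < ε ∧ ε < 1 ∧ ∃ T0 : ℝ, 0 < T0 ∧
    ∀ t0 : ℝ, 0 ≤ t0 → ∀ x : ℝ → Fin n → ℝ, CSol n W t0 x →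
      ∀ t, t0 ≤ t → cH n x (t + T0) ≤ ε * cH n x t

/-- Condition (b): uniformly positive integrals over windows of length `τ0` for persistent arcs. -/
def CArcCond (n : ℕ) (W : ℝ → Fin n → Fin n → ℝ) : Prop :=
  ∃ a : ℝ, 0 < a ∧ ∃ τ : ℝ, 0 < τ ∧
    ∀ t : ℝ, 0 ≤ t → ∀ j i : Fin n, CPersistent n W j i →
      a ≤ ∫ s in t..(t + τ), W s i j

open scoped Classical in
/-- θ(t): total weight at time `t` over non-persistent ordered pairs of distinct nodes. -/
noncomputable def cTheta (n : ℕ) (W : ℝ → Fin n → Fin n → ℝ) (t : ℝ) : ℝ :=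
  ∑ i : Fin n, ∑ j : Fin n, if j ≠ i ∧ ¬ CPersistent n W j i then W t i j else 0

/-- ξ⁺(t;m) = ∑_{j ≠ m} W_mj(t). -/
def cXi (n : ℕ) (W : ℝ → Fin n → Fin n → ℝ) (t : ℝ) (m : Fin n) : ℝ :=
  ∑ j ∈ Finset.univ.erase m, W t m j


lemma ac_comp {F φ : ℝ → ℝ} {a b : ℝ} {K : NNReal}
    (hF : AbsolutelyContinuousOnInterval F a b)
    (hφ : LipschitzOnWith K φ (F '' Set.uIcc a b)) :
    AbsolutelyContinuousOnInterval (fun t => φ (F t)) a b := by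
  have h := Filter.Tendsto.const_mul (K : ℝ) hF
  rw [mul_zero] at h
  refine squeeze_zero' (Eventually.of_forall fun t => Finset.sum_nonneg fun i _ => dist_nonneg)
    ?_ h
  refine Filter.Eventually.filter_mono inf_le_right ?_
  rw [Filter.eventually_principal]
  intro E hE
  rw [Finset.mul_sum]
  refine Finset.sum_le_sum fun i hi => ?_
  have := hE.1 i hi
  exact hφ.dist_le_mul _ (Set.mem_image_of_mem _ this.1) _ (Set.mem_image_of_mem _ this.2)

lemma exp_ac {F : ℝ → ℝ} {a b : ℝ}
    (hF : AbsolutelyContinuousOnInterval F a b) :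
    AbsolutelyContinuousOnInterval (fun t => Real.exp (F t)) a b := by
  obtain ⟨C, hC⟩ := hF.exists_bound
  obtain ⟨K, hK⟩ := (Real.contDiff_exp (n := 1)).contDiffOn.exists_lipschitzOnWith (by decide)
    (convex_Icc (-C) C) isCompact_Icc
  refine ac_comp hF (hK.mono ?_)
  rintro _ ⟨t, ht, rfl⟩
  have := hC t ht
  rw [Real.norm_eq_abs, abs_le] at this
  exact this

lemma comparison {y g D f : ℝ → ℝ} {a b : ℝ} (hab : a ≤ b)
    (hg : IntervalIntegrable g volume a b) (hD : IntervalIntegrable D volume a b)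
    (hf : IntervalIntegrable f volume a b)
    (hD0 : ∀ t ∈ Set.Icc a b, 0 ≤ D t) (hf0 : ∀ t ∈ Set.Icc a b, 0 ≤ f t)
    (hy : ∀ t ∈ Set.Icc a b, y t = y a + ∫ s in a..t, g s)
    (h : ∀ t ∈ Set.Ico a b, f t - D t * y t ≤ g t) :
    Real.exp (- ∫ s in a..b, D s) * (y a + ∫ s in a..b, f s) ≤ y b := by
  have hmem : a ∈ Set.uIcc a b := Set.left_mem_uIcc
  have hF := hD.absolutelyContinuousOnInterval_intervalIntegral hmem
  have hE := exp_ac hF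
  have hG := hg.absolutelyContinuousOnInterval_intervalIntegral hmem
  have hc : AbsolutelyContinuousOnInterval (fun _ : ℝ => y a) a b :=
    (contDiff_const (n := 1)).contDiffOn.absolutelyContinuousOnInterval
  have hY := hc.fun_add hG
  have key := hE.integral_deriv_mul_eq_sub hY
  have hint : IntervalIntegrable (fun x => deriv (fun t => Real.exp (∫ v in a..t, D v)) x *
      (y a + ∫ v in a..x, g v) + Real.exp (∫ v in a..x, D v) *
        deriv (fun t => y a + ∫ v in a..t, g v) x) volume a b :=
    (hE.intervalIntegrable_deriv.mul_continuousOn hY.continuousOn).add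
      (hY.intervalIntegrable_deriv.continuousOn_mul hE.continuousOn)
  have hne : ∀ᵐ x : ℝ, x ≠ b := by simp [ae_iff, measure_singleton]
  have hmono : ∫ s in a..b, f s ≤ ∫ x in a..b, (deriv (fun t => Real.exp (∫ v in a..t, D v)) x *
      (y a + ∫ v in a..x, g v) + Real.exp (∫ v in a..x, D v) *
        deriv (fun t => y a + ∫ v in a..t, g v) x) := by
    refine intervalIntegral.integral_mono_ae_restrict hab hf hint ?_
    rw [Filter.EventuallyLE, ae_restrict_iff' measurableSet_Icc]
    filter_upwards [hne, hD.ae_hasDerivAt_integral, hg.ae_hasDerivAt_integral] with x h0 h1 h2 hx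
    rw [← Set.uIcc_of_le hab] at hx
    have d1 := (h1 hx a hmem).exp.deriv
    have d2 := ((h2 hx a hmem).const_add (y a)).deriv
    rw [d1, d2]
    rw [Set.uIcc_of_le hab] at hx
    rw [← hy x hx]
    have e1 : 1 ≤ Real.exp (∫ v in a..x, D v) := by
      apply Real.one_le_exp
      exact intervalIntegral.integral_nonneg hx.1 fun u hu => hD0 u ⟨hu.1, hu.2.trans hx.2⟩
    have := h x ⟨hx.1, lt_of_le_of_ne hx.2 h0⟩
    have := hf0 x hx
    nlinarith
  rw [key] at hmono
  have hb := hy b ⟨hab, le_rfl⟩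
  rw [← hb] at hmono
  simp only [intervalIntegral.integral_same, Real.exp_zero, one_mul, add_zero] at hmono
  rw [Real.exp_neg, inv_mul_le_iff₀ (Real.exp_pos _)]
  linarith

lemma stay_pos {ι : Type*} [Finite ι] (S : Set ι) {z g D : ℝ → ι → ℝ} {a b : ℝ} (hab : a ≤ b)
    (hz : ∀ i ∈ S, ContinuousOn (fun t => z t i) (Set.Icc a b))
    (hg : ∀ i ∈ S, IntervalIntegrable (fun t => g t i) volume a b)
    (hD : ∀ i ∈ S, IntervalIntegrable (fun t => D t i) volume a b)
    (hD0 : ∀ i ∈ S, ∀ t ∈ Set.Icc a b, 0 ≤ D t i)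
    (hy : ∀ i ∈ S, ∀ t ∈ Set.Icc a b, z t i = z a i + ∫ s in a..t, g s i)
    (h : ∀ t ∈ Set.Icc a b, (∀ j ∈ S, 0 ≤ z t j) → ∀ i ∈ S, - (D t i * z t i) ≤ g t i)
    (ha : ∀ i ∈ S, 0 < z a i) : ∀ i ∈ S, 0 < z b i := by
  by_contra hcon
  push Not at hcon
  obtain ⟨i0, hi0, hb⟩ := hcon
  set B : Set ℝ := ⋃ i ∈ S, (Set.Icc a b ∩ (fun t => z t i) ⁻¹' Set.Iic 0) with hB
  have hBc : IsClosed B :=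
    (Set.toFinite S).isClosed_biUnion fun i hi =>
      (hz i hi).preimage_isClosed_of_isClosed isClosed_Icc isClosed_Iic
  have hBsub : B ⊆ Set.Icc a b := Set.iUnion₂_subset fun i _ => Set.inter_subset_left
  have hBcomp : IsCompact B := isCompact_Icc.of_isClosed_subset hBc hBsub
  have hBne : B.Nonempty := ⟨b, Set.mem_biUnion hi0 ⟨⟨hab, le_rfl⟩, hb⟩⟩
  obtain ⟨τ, hτ, hmin⟩ := hBcomp.exists_isLeast hBne
  have hτI := hBsub hτ
  simp only [hB, Set.mem_iUnion] at hτ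
  obtain ⟨i, hi, -, hzi⟩ := hτ
  have hpos : ∀ t ∈ Set.Ico a τ, ∀ j ∈ S, 0 ≤ z t j := by
    intro t ht j hj
    by_contra hneg
    have : t ∈ B := Set.mem_biUnion hj ⟨⟨ht.1, ht.2.le.trans hτI.2⟩, (not_le.1 hneg).le⟩
    exact absurd (hmin this) (not_le.2 ht.2)
  have hsub : Set.uIcc a τ ⊆ Set.uIcc a b := by
    rw [Set.uIcc_of_le hτI.1, Set.uIcc_of_le hab]
    exact Set.Icc_subset_Icc_right hτI.2
  have hc := comparison (y := fun t => z t i) (g := fun t => g t i) (D := fun t => D t i)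
    (f := fun _ => 0) hτI.1 ((hg i hi).mono_set hsub) ((hD i hi).mono_set hsub)
    intervalIntegrable_const
    (fun t ht => hD0 i hi t ⟨ht.1, ht.2.trans hτI.2⟩) (fun _ _ => le_rfl)
    (fun t ht => hy i hi t ⟨ht.1, ht.2.trans hτI.2⟩)
    (fun t ht => by
      have := h t ⟨ht.1, ht.2.le.trans hτI.2⟩ (hpos t ht) i hi
      simpa using this)
  simp only [intervalIntegral.integral_zero, add_zero] at hc
  have := mul_pos (Real.exp_pos (-∫ s in a..τ, D s i)) (ha i hi)
  have h3 : z τ i ≤ 0 := hzi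
  linarith

lemma ii_sum {ι : Type*} (s : Finset ι) {f : ι → ℝ → ℝ} {a b : ℝ}
    (h : ∀ i ∈ s, IntervalIntegrable (f i) volume a b) :
    IntervalIntegrable (fun t => ∑ i ∈ s, f i t) volume a b := by
  have := IntervalIntegrable.sum s h
  have e : (∑ i ∈ s, f i) = fun t => ∑ i ∈ s, f i t := by
    ext t
    simp
  rwa [e] at this

section sol
variable {n : ℕ} {W : ℝ → Fin n → Fin n → ℝ} {t0 : ℝ} {x : ℝ → Fin n → ℝ}

lemma W_int (hreg : CRegular n W) (i j : Fin n) (a b : ℝ) :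
    IntervalIntegrable (fun t => W t i j) volume a b :=
  ((hreg.2.2 i j).integrableOn_isCompact isCompact_uIcc).intervalIntegrable

lemma xi_int (hreg : CRegular n W) (i : Fin n) (a b : ℝ) :
    IntervalIntegrable (fun t => cXi n W t i) volume a b := by
  unfold cXi
  exact ii_sum _ fun j _ => W_int hreg i j a b

lemma xi_nonneg (hreg : CRegular n W) (t : ℝ) (i : Fin n) : 0 ≤ cXi n W t i :=
  Finset.sum_nonneg fun j _ => hreg.1 t i j

lemma sol_cont (hx : CSol n W t0 x) (i : Fin n) {a b : ℝ} (ha : t0 ≤ a) :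
    ContinuousOn (fun t => x t i) (Set.Icc a b) :=
  (hx.1 i).mono fun _ ht => ha.trans ht.1

lemma sol_int1 (hreg : CRegular n W) (hx : CSol n W t0 x) (i j k : Fin n) (c : ℝ) {a b : ℝ}
    (ha : t0 ≤ a) (hab : a ≤ b) :
    IntervalIntegrable (fun t => W t i j * (x t k - c)) volume a b := by
  refine (W_int hreg i j a b).mul_continuousOn ?_
  rw [Set.uIcc_of_le hab]
  exact (sol_cont hx k ha).sub continuousOn_const

lemma sol_int (hreg : CRegular n W) (hx : CSol n W t0 x) (i : Fin n) {a b : ℝ}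
    (ha : t0 ≤ a) (hab : a ≤ b) :
    IntervalIntegrable (fun t => ∑ j, W t i j * (x t j - x t i)) volume a b := by
  refine ii_sum _ fun j _ => ?_
  refine (W_int hreg i j a b).mul_continuousOn ?_
  rw [Set.uIcc_of_le hab]
  exact (sol_cont hx j ha).sub (sol_cont hx i ha)

lemma sol_shift (hreg : CRegular n W) (hx : CSol n W t0 x) (i : Fin n) {a t : ℝ}
    (ha : t0 ≤ a) (hat : a ≤ t) :
    x t i = x a i + ∫ s in a..t, ∑ j, W s i j * (x s j - x s i) := by
  rw [hx.2 i t (ha.trans hat), hx.2 i a ha, add_assoc,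
    intervalIntegral.integral_add_adjacent_intervals (sol_int hreg hx i le_rfl ha)
      (sol_int hreg hx i ha hat)]

lemma sol_neg (hx : CSol n W t0 x) : CSol n W t0 (fun t i => - x t i) := by
  refine ⟨fun i => (hx.1 i).neg, fun i t ht => ?_⟩
  simp only
  rw [hx.2 i t ht, neg_add, ← intervalIntegral.integral_neg]
  congr 2
  ext s
  rw [← Finset.sum_neg_distrib]
  exact Finset.sum_congr rfl fun j _ => by ring

lemma alg_id (t : ℝ) (i : Fin n) (c : ℝ) :
    ∑ j, W t i j * (x t j - x t i) =
      ∑ j ∈ univ.erase i, W t i j * (x t j - c) - cXi n W t i * (x t i - c) := by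
  rw [← Finset.add_sum_erase _ _ (Finset.mem_univ i), cXi, Finset.sum_mul,
    ← Finset.sum_sub_distrib, sub_self, mul_zero, zero_add]
  exact Finset.sum_congr rfl fun j _ => by ring

lemma sol_lower (hreg : CRegular n W) (hx : CSol n W t0 x) {a b c : ℝ}
    (ha : t0 ≤ a) (hab : a ≤ b) (hc : ∀ j, c ≤ x a j) (j : Fin n) : c ≤ x b j := by
  refine le_of_forall_pos_le_add fun ε hε => ?_
  have := stay_pos (Set.univ : Set (Fin n)) (z := fun t i => x t i - (c - ε))
    (g := fun t i => ∑ j, W t i j * (x t j - x t i)) (D := fun t i => cXi n W t i) hab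
    (fun i _ => (sol_cont hx i ha).sub continuousOn_const)
    (fun i _ => sol_int hreg hx i ha hab) (fun i _ => xi_int hreg i a b)
    (fun i _ t _ => xi_nonneg hreg t i)
    (fun i _ t ht => by
      rw [sol_shift hreg hx i ha ht.1]; ring)
    (fun t ht hj i _ => by
      rw [alg_id t i (c - ε)]
      have : 0 ≤ ∑ j ∈ univ.erase i, W t i j * (x t j - (c - ε)) :=
        Finset.sum_nonneg fun j _ => mul_nonneg (hreg.1 t i j) (hj j trivial)
      linarith)
    (fun i _ => by have := hc i; linarith) j trivial
  linarith

lemma sol_upper (hreg : CRegular n W) (hx : CSol n W t0 x) {a b c : ℝ}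
    (ha : t0 ≤ a) (hab : a ≤ b) (hc : ∀ j, x a j ≤ c) (j : Fin n) : x b j ≤ c := by
  have := sol_lower hreg (sol_neg hx) ha hab (c := -c) (fun j => neg_le_neg (hc j)) j
  exact neg_le_neg_iff.1 this

lemma sol_keep (hreg : CRegular n W) (hx : CSol n W t0 x) {a b c : ℝ}
    (ha : t0 ≤ a) (hab : a ≤ b) (hc : ∀ j, c ≤ x a j) (i : Fin n) :
    Real.exp (- ∫ s in a..b, cXi n W s i) * (x a i - c) ≤ x b i - c := by
  have := comparison (y := fun t => x t i - c)
    (g := fun t => ∑ j, W t i j * (x t j - x t i)) (D := fun t => cXi n W t i)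
    (f := fun _ => 0) hab (sol_int hreg hx i ha hab) (xi_int hreg i a b)
    intervalIntegrable_const (fun t _ => xi_nonneg hreg t i) (fun _ _ => le_rfl)
    (fun t ht => by
      rw [sol_shift hreg hx i ha ht.1]; ring)
    (fun t ht => by
      rw [alg_id t i c]
      have : 0 ≤ ∑ j ∈ univ.erase i, W t i j * (x t j - c) :=
        Finset.sum_nonneg fun j _ => mul_nonneg (hreg.1 t i j)
          (sub_nonneg.2 (sol_lower hreg hx ha ht.1 hc j))
      linarith)
  simpa using this

lemma sol_gain (hreg : CRegular n W) (hx : CSol n W t0 x) {a b c : ℝ}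
    (ha : t0 ≤ a) (hab : a ≤ b) (hc : ∀ j, c ≤ x a j) {i j : Fin n} (hij : j ≠ i) :
    Real.exp (- ∫ s in a..b, cXi n W s i) * (∫ s in a..b, W s i j * (x s j - c))
      ≤ x b i - c := by
  have hf0 : ∀ t ∈ Set.Icc a b, ∀ k, 0 ≤ W t i k * (x t k - c) := fun t ht k =>
    mul_nonneg (hreg.1 t i k) (sub_nonneg.2 (sol_lower hreg hx ha ht.1 hc k))
  have := comparison (y := fun t => x t i - c)
    (g := fun t => ∑ j, W t i j * (x t j - x t i)) (D := fun t => cXi n W t i)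
    (f := fun t => W t i j * (x t j - c)) hab (sol_int hreg hx i ha hab) (xi_int hreg i a b)
    (sol_int1 hreg hx i j j c ha hab) (fun t _ => xi_nonneg hreg t i)
    (fun t ht => hf0 t ht j)
    (fun t ht => by
      rw [sol_shift hreg hx i ha ht.1]; ring)
    (fun t ht => by
      rw [alg_id t i c]
      have : W t i j * (x t j - c) ≤ ∑ j ∈ univ.erase i, W t i j * (x t j - c) :=
        Finset.single_le_sum (f := fun j => W t i j * (x t j - c))
          (fun k _ => hf0 t ⟨ht.1, ht.2.le⟩ k)
          (Finset.mem_erase.2 ⟨hij, Finset.mem_univ j⟩)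
      linarith)
  refine le_trans (mul_le_mul_of_nonneg_left ?_ (Real.exp_pos _).le) this
  have := hc i
  linarith

lemma nonpers_bdd (hreg : CRegular n W) {i j : Fin n} (hji : j ≠ i) (h : ¬ CPersistent n W j i)
    (t0 : ℝ) : ∃ C, ∀ a b, t0 ≤ a → a ≤ b → ∫ t in a..b, W t i j ≤ C := by
  have hmono : ∀ {a b c d : ℝ}, c ≤ a → a ≤ b → b ≤ d →
      ∫ t in a..b, W t i j ≤ ∫ t in c..d, W t i j := fun h1 h2 h3 =>
    intervalIntegral.integral_mono_interval h1 h2 h3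
      (Filter.Eventually.of_forall fun t => hreg.1 t i j) (W_int hreg i j _ _)
  have : ∃ s : ℝ, 0 ≤ s ∧ ∃ C, ∀ T, s ≤ T → ∫ t in s..T, W t i j ≤ C := by
    by_contra hcon
    push Not at hcon
    refine h ⟨hji, fun s hs => ?_⟩
    rw [tendsto_atTop_atTop]
    intro C
    obtain ⟨T, hT, hC⟩ := hcon s hs C
    exact ⟨T, fun a ha => hC.le.trans (hmono le_rfl hT ha)⟩
  obtain ⟨s, -, C, hC⟩ := this
  refine ⟨(∫ t in (min t0 s)..s, W t i j) + C, fun a b ha hab => ?_⟩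
  have h1 := hmono (min_le_left t0 s |>.trans ha) hab (le_max_left b s)
  rw [← intervalIntegral.integral_add_adjacent_intervals (W_int hreg i j (min t0 s) s)
    (W_int hreg i j s (max b s))] at h1
  linarith [hC (max b s) (le_max_right b s)]

lemma theta_int (hreg : CRegular n W) (a b : ℝ) :
    IntervalIntegrable (fun t => cTheta n W t) volume a b := by
  unfold cTheta
  refine ii_sum _ fun i _ => ii_sum _ fun j _ => ?_
  split_ifs
  · exact W_int hreg i j a b
  · exact intervalIntegrable_const

lemma theta_nonneg (hreg : CRegular n W) (t : ℝ) : 0 ≤ cTheta n W t := by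
  unfold cTheta
  refine Finset.sum_nonneg fun i _ => Finset.sum_nonneg fun j _ => ?_
  split_ifs
  · exact hreg.1 t i j
  · exact le_rfl

open scoped Classical in
lemma theta_bdd (hreg : CRegular n W) :
    ∃ C, ∀ a b, 0 ≤ a → a ≤ b → ∫ t in a..b, cTheta n W t ≤ C := by
  have h : ∀ i j : Fin n, ∃ C, ∀ a b : ℝ, 0 ≤ a → a ≤ b →
      ∫ t in a..b, (if j ≠ i ∧ ¬ CPersistent n W j i then W t i j else 0) ≤ C := by
    intro i j
    by_cases hc : j ≠ i ∧ ¬ CPersistent n W j i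
    · simp only [if_pos hc]
      exact nonpers_bdd hreg hc.1 hc.2 0
    · simp only [if_neg hc]
      exact ⟨0, fun a b _ _ => by simp⟩
  choose C hC using h
  refine ⟨∑ i, ∑ j, C i j, fun a b ha hab => ?_⟩
  have hint : ∀ i j : Fin n, IntervalIntegrable
      (fun t => if j ≠ i ∧ ¬ CPersistent n W j i then W t i j else 0) volume a b := by
    intro i j
    split_ifs
    · exact W_int hreg i j a b
    · exact intervalIntegrable_const
  unfold cTheta
  rw [intervalIntegral.integral_finsetSum fun i _ => ii_sum _ fun j _ => hint i j]
  refine Finset.sum_le_sum fun i _ => ?_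
  rw [intervalIntegral.integral_finsetSum fun j _ => hint i j]
  exact Finset.sum_le_sum fun j _ => hC i j a b ha hab

lemma theta_tail (hreg : CRegular n W) {η : ℝ} (hη : 0 < η) :
    ∃ t0 : ℝ, 0 ≤ t0 ∧ ∀ b, t0 ≤ b → ∫ t in t0..b, cTheta n W t ≤ η := by
  obtain ⟨C, hC⟩ := theta_bdd hreg
  set S : Set ℝ := (fun T => ∫ t in (0:ℝ)..T, cTheta n W t) '' Set.Ici 0 with hS
  have hne : S.Nonempty := ⟨_, 0, Set.self_mem_Ici, rfl⟩
  have hbd : BddAbove S := ⟨C, by rintro _ ⟨T, hT, rfl⟩; exact hC 0 T le_rfl hT⟩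
  obtain ⟨_, ⟨t0, ht0, rfl⟩, hlt⟩ := exists_lt_of_lt_csSup hne (sub_lt_self (sSup S) hη)
  refine ⟨t0, ht0, fun b hb => ?_⟩
  have h1 : ∫ t in (0:ℝ)..b, cTheta n W t ≤ sSup S :=
    le_csSup hbd ⟨b, le_trans ht0 hb, rfl⟩
  rw [← intervalIntegral.integral_add_adjacent_intervals (theta_int hreg 0 t0)
    (theta_int hreg t0 b)] at h1
  simp only at hlt
  linarith

open scoped Classical in
lemma closed_lower (hreg : CRegular n W) (hx : CSol n W t0 x) (V : Set (Fin n))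
    (hV : ∀ i ∈ V, ∀ j, CPersistent n W j i → j ∈ V) {u : ℝ}
    (h0 : ∀ j, u - 1 ≤ x t0 j) (h1 : ∀ j, x t0 j ≤ u) (hVu : ∀ i ∈ V, u ≤ x t0 i)
    {b : ℝ} (hb : t0 ≤ b) (i : Fin n) (hi : i ∈ V) :
    u - ∫ t in t0..b, cTheta n W t ≤ x b i := by
  refine le_of_forall_pos_le_add fun ε hε => ?_
  have := stay_pos V (z := fun t i => x t i - u + ε + ∫ s in t0..t, cTheta n W s)
    (g := fun t i => (∑ j, W t i j * (x t j - x t i)) + cTheta n W t)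
    (D := fun t i => cXi n W t i) hb
    (fun i _ => by
      refine (((sol_cont hx i le_rfl).sub continuousOn_const).add continuousOn_const).add ?_
      have := ((theta_int hreg t0 b).absolutelyContinuousOnInterval_intervalIntegral
        Set.left_mem_uIcc).continuousOn
      rwa [Set.uIcc_of_le hb] at this)
    (fun i _ => (sol_int hreg hx i le_rfl hb).add (theta_int hreg t0 b))
    (fun i _ => xi_int hreg i t0 b)
    (fun i _ t _ => xi_nonneg hreg t i)
    (fun i _ t ht => by
      rw [intervalIntegral.integral_add (sol_int hreg hx i le_rfl ht.1) (theta_int hreg t0 t),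
        hx.2 i t ht.1]
      simp only [intervalIntegral.integral_same]
      ring)
    (fun t ht hz i hi => by
      have hlo := fun j => sol_lower hreg hx le_rfl ht.1 h0 j
      have hup := fun j => sol_upper hreg hx le_rfl ht.1 h1 j
      have hzi := hz i hi
      set zi := x t i - u + ε + ∫ s in t0..t, cTheta n W s with hzi_def
      have hrow : ∑ j, (if j ≠ i ∧ ¬ CPersistent n W j i then W t i j else 0)
          ≤ cTheta n W t := by
        unfold cTheta
        refine Finset.single_le_sum (f := fun i => ∑ j,
          (if j ≠ i ∧ ¬ CPersistent n W j i then W t i j else 0)) (fun k _ => ?_)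
          (Finset.mem_univ i)
        refine Finset.sum_nonneg fun j _ => ?_
        split_ifs
        · exact hreg.1 t k j
        · exact le_rfl
      have hmain : -(cXi n W t i * zi) -
          ∑ j, (if j ≠ i ∧ ¬ CPersistent n W j i then W t i j else 0)
          ≤ ∑ j, W t i j * (x t j - x t i) := by
        rw [← Finset.add_sum_erase _ _ (Finset.mem_univ i),
          ← Finset.add_sum_erase _ (fun j => W t i j * (x t j - x t i)) (Finset.mem_univ i),
          cXi, Finset.sum_mul]
        simp only [ne_eq, not_true_eq_false, false_and, if_false, zero_add, sub_self, mul_zero]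
        rw [← Finset.sum_neg_distrib, ← Finset.sum_sub_distrib]
        refine Finset.sum_le_sum fun j hj => ?_
        have hji := Finset.ne_of_mem_erase hj
        have hw := hreg.1 t i j
        by_cases hp : CPersistent n W j i
        · rw [if_neg (by tauto)]
          have hzj := hz j (hV i hi j hp)
          have : x t j - x t i ≥ -zi := by linarith
          nlinarith
        · rw [if_pos ⟨hji, hp⟩]
          have h2 := hlo j
          have h3 := hup i
          have : x t j - x t i ≥ -zi - 1 := by linarith
          nlinarith
      linarith)
    (fun i hi => by
      have := hVu i hi
      simp only [intervalIntegral.integral_same]; linarith) i hi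
  linarith

end sol

lemma reach_trans {α : Type*} {R : α → α → Prop} : ∀ (k : ℕ) {l : ℕ} {a b c : α},
    ReachIn R k a b → ReachIn R l b c → ∃ m, ReachIn R m a c
  | 0, l, a, b, c, h1, h2 => by
      have : a = b := h1
      subst this
      exact ⟨l, h2⟩
  | k + 1, l, a, b, c, h1, h2 => by
      obtain ⟨m, hm, h3⟩ := h1
      obtain ⟨q, hq⟩ := reach_trans k h3 h2
      exact ⟨q + 1, m, hm, hq⟩

lemma no_center {α : Type*} [Finite α] [Nonempty α] (R : α → α → Prop)
    (h : ¬ ∃ c : α, ∀ v : α, ∃ k, ReachIn R k c v) :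
    ∃ u v : α, ∀ w, (∃ k, ReachIn R k w u) → (∃ k, ReachIn R k w v) → False := by
  by_contra hcon
  push Not at hcon
  apply h
  let r : α → α → Prop := fun a b => ∃ k, ReachIn R k b a
  have : IsTrans α r := ⟨fun a b c ⟨k, hk⟩ ⟨l, hl⟩ => reach_trans l hl hk⟩
  have hd : Directed r (id : α → α) := fun a b => by
    obtain ⟨w, h1, h2⟩ := hcon a b
    exact ⟨w, h1, h2.1⟩
  exact hd.finite_le id

lemma x_le_cMax {n : ℕ} (x : ℝ → Fin n → ℝ) (t : ℝ) (i : Fin n) : x t i ≤ cMax n x t :=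
  le_ciSup (Set.finite_range _).bddAbove i

lemma cMin_le_x {n : ℕ} (x : ℝ → Fin n → ℝ) (t : ℝ) (i : Fin n) : cMin n x t ≤ x t i :=
  ciInf_le (Set.finite_range _).bddBelow i

open scoped Classical in
lemma necessity {n : ℕ} (hn : 2 ≤ n) {W : ℝ → Fin n → Fin n → ℝ} (hreg : CRegular n W)
    (hex : CSolExists n W) (hag : CAgree n W) : CQSC n W := by
  have : Nonempty (Fin n) := ⟨⟨0, by omega⟩⟩
  by_contra hq
  obtain ⟨u, v, huv⟩ := no_center (CPersistent n W) hq
  obtain ⟨t0, ht0, htail⟩ := theta_tail hreg (η := 1/4) (by norm_num)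
  set Vu : Set (Fin n) := {w | ∃ k, ReachIn (CPersistent n W) k w u} with hVu
  set Vv : Set (Fin n) := {w | ∃ k, ReachIn (CPersistent n W) k w v} with hVv
  have hcl : ∀ y : Fin n, ∀ i ∈ {w | ∃ k, ReachIn (CPersistent n W) k w y}, ∀ j,
      CPersistent n W j i → j ∈ {w | ∃ k, ReachIn (CPersistent n W) k w y} := by
    rintro y i ⟨k, hk⟩ j hj
    exact ⟨k + 1, i, hj, hk⟩
  obtain ⟨x, hx, hx0⟩ := hex t0 ht0 (fun i => if i ∈ Vu then 0 else 1)
  have h01 : ∀ i, 0 ≤ x t0 i ∧ x t0 i ≤ 1 := by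
    intro i
    rw [hx0 i]
    split_ifs <;> norm_num
  have hfar : ∀ t, t0 ≤ t → 1/2 ≤ cH n x t := by
    intro t ht
    have h1 := closed_lower hreg hx Vv (hcl v) (u := 1) (fun j => by simpa using (h01 j).1)
      (fun j => (h01 j).2) (fun i hi => by
        rw [hx0 i, if_neg]
        exact fun hi' => huv i hi' hi) ht v ⟨0, rfl⟩
    have h2 := closed_lower hreg (sol_neg hx) Vu (hcl u) (u := 0)
      (fun j => by have := (h01 j).2; linarith)
      (fun j => by have := (h01 j).1; linarith) (fun i hi => by
        rw [hx0 i, if_pos hi]; simp) ht u ⟨0, rfl⟩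
    have h3 := htail t ht
    have h4 := x_le_cMax x t v
    have h5 := cMin_le_x x t u
    unfold cH
    linarith
  have hlim := hag t0 ht0 x hx
  have : (1/2 : ℝ) ≤ 0 := ge_of_tendsto hlim
    (Filter.eventually_atTop.2 ⟨t0, hfar⟩)
  norm_num at this

section suff
variable {n : ℕ} {W : ℝ → Fin n → Fin n → ℝ} {t0 : ℝ} {x : ℝ → Fin n → ℝ}

lemma exists_window (hreg : CRegular n W) {i j : Fin n} (h : CPersistent n W j i) {s : ℝ}
    (hs : 0 ≤ s) : ∃ T, s ≤ T ∧ ∫ t in s..T, W t i j = 1 := by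
  obtain ⟨T1, hT1, h1⟩ := ((Filter.tendsto_atTop.1 (h.2 s hs) 1).and
    (Filter.eventually_ge_atTop s)).exists
  have hc := ((W_int hreg i j s T1).absolutelyContinuousOnInterval_intervalIntegral
        Set.left_mem_uIcc).continuousOn
  rw [Set.uIcc_of_le h1] at hc
  obtain ⟨T, hT, hT2⟩ := intermediate_value_Icc h1 hc
    (show (1:ℝ) ∈ _ from ⟨by simp, hT1⟩)
  exact ⟨T, hT.1, hT2⟩

lemma window_bound (hreg : CRegular n W) {A : ℝ} (hA3 : CArcBalance n W A) {i0 j0 : Fin n}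
    (h0 : CPersistent n W j0 i0) (ht0 : 0 ≤ t0) :
    ∃ M, 0 ≤ M ∧ ∀ i s T, t0 ≤ s → s ≤ T → ∫ t in s..T, W t i0 j0 = 1 →
      ∫ t in s..T, cXi n W t i ≤ M := by
  have hK : ∀ i j : Fin n, ∃ K, j ≠ i → ∀ s T, t0 ≤ s → s ≤ T → ∫ t in s..T, W t i0 j0 = 1 →
      ∫ t in s..T, W t i j ≤ K := by
    intro i j
    by_cases hp : CPersistent n W j i
    · refine ⟨A, fun _ s T hs hsT h1 => ?_⟩
      have : ∫ t in s..T, W t i j ≤ ∫ t in s..T, A * W t i0 j0 :=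
        intervalIntegral.integral_mono_on hsT (W_int hreg i j s T)
          ((W_int hreg i0 j0 s T).const_mul A)
          (fun t ht => (hA3 t (ht0.trans (hs.trans ht.1)) i0 j0 i j h0 hp).2)
      rw [intervalIntegral.integral_const_mul, h1, mul_one] at this
      exact this
    · by_cases hji : j = i
      · exact ⟨0, fun h => absurd hji h⟩
      · obtain ⟨C, hC⟩ := nonpers_bdd hreg hji hp t0
        exact ⟨C, fun _ s T hs hsT _ => hC s T hs hsT⟩
  choose K hK using hK
  obtain ⟨M, hM⟩ := Finite.exists_le (fun i => ∑ j ∈ univ.erase i, K i j)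
  refine ⟨max M 0, le_max_right _ _, fun i s T hs hsT h1 => ?_⟩
  refine le_trans ?_ ((hM i).trans (le_max_left _ _))
  unfold cXi
  rw [intervalIntegral.integral_finsetSum fun j _ => W_int hreg i j s T]
  exact Finset.sum_le_sum fun j hj => hK i j (Finset.ne_of_mem_erase hj) s T hs hsT h1

lemma step_keep (hreg : CRegular n W) (hx : CSol n W t0 x) {a b c M : ℝ}
    (ha : t0 ≤ a) (hab : a ≤ b) (hc : ∀ j, c ≤ x a j)
    (hM : ∀ i, ∫ t in a..b, cXi n W t i ≤ M) (i : Fin n) :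
    Real.exp (-M) * (x a i - c) ≤ x b i - c := by
  refine le_trans (mul_le_mul_of_nonneg_right ?_ (sub_nonneg.2 (hc i)))
    (sol_keep hreg hx ha hab hc i)
  exact Real.exp_le_exp.2 (neg_le_neg (hM i))

lemma step_gain (hreg : CRegular n W) (hx : CSol n W t0 x) {a b c M q : ℝ}
    (ha : t0 ≤ a) (hab : a ≤ b) (hc : ∀ j, c ≤ x a j)
    (hM : ∀ i, ∫ t in a..b, cXi n W t i ≤ M) {i j : Fin n} (hji : j ≠ i)
    (hq0 : 0 ≤ q) (hq : q ≤ ∫ t in a..b, W t i j) :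
    Real.exp (-M) * (Real.exp (-M) * q) * (x a j - c) ≤ x b i - c := by
  have hd : 0 ≤ x a j - c := sub_nonneg.2 (hc j)
  have hE := Real.exp_pos (-M)
  have hlow : ∀ t ∈ Set.Icc a b, Real.exp (-M) * (x a j - c) ≤ x t j - c := by
    intro t ht
    refine step_keep hreg hx ha ht.1 hc (fun k => le_trans ?_ (hM k)) j
    exact intervalIntegral.integral_mono_interval le_rfl ht.1 ht.2
      (Filter.Eventually.of_forall fun t => xi_nonneg hreg t k) (xi_int hreg k _ _)
  have hI : (∫ t in a..b, W t i j) * (Real.exp (-M) * (x a j - c)) ≤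
      ∫ t in a..b, W t i j * (x t j - c) := by
    rw [← intervalIntegral.integral_mul_const]
    exact intervalIntegral.integral_mono_on hab ((W_int hreg i j a b).mul_const _)
      (sol_int1 hreg hx i j j c ha hab)
      (fun t ht => mul_le_mul_of_nonneg_left (hlow t ht) (hreg.1 t i j))
  have hI2 : q * (Real.exp (-M) * (x a j - c)) ≤ ∫ t in a..b, W t i j * (x t j - c) :=
    le_trans (mul_le_mul_of_nonneg_right hq (by positivity)) hI
  have h0 : 0 ≤ ∫ t in a..b, W t i j * (x t j - c) := le_trans (by positivity) hI2
  calc Real.exp (-M) * (Real.exp (-M) * q) * (x a j - c)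
      = Real.exp (-M) * (q * (Real.exp (-M) * (x a j - c))) := by ring
    _ ≤ Real.exp (-M) * ∫ t in a..b, W t i j * (x t j - c) :=
        mul_le_mul_of_nonneg_left hI2 hE.le
    _ ≤ Real.exp (- ∫ s in a..b, cXi n W s i) * ∫ t in a..b, W t i j * (x t j - c) :=
        mul_le_mul_of_nonneg_right (Real.exp_le_exp.2 (neg_le_neg (hM i))) h0
    _ ≤ _ := sol_gain hreg hx ha hab hc hji

lemma sufficiency (hn : 2 ≤ n) (hreg : CRegular n W)
    {A : ℝ} (hA : 1 < A) (hA3 : CArcBalance n W A) (hq : CQSC n W) : CAgree n W := by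
  intro t0 ht0 x hx
  have hne : Nonempty (Fin n) := ⟨⟨0, by omega⟩⟩
  obtain ⟨c, hcen⟩ := hq
  have harc : ∃ i0 j0, CPersistent n W j0 i0 := by
    obtain ⟨v, hv⟩ : ∃ v : Fin n, c ≠ v := by
      have : Nontrivial (Fin n) := Fin.nontrivial_iff_two_le.2 hn
      obtain ⟨v, hv⟩ := exists_ne c
      exact ⟨v, hv.symm⟩
    obtain ⟨k, hk⟩ := hcen v
    cases k with
    | zero => exact absurd hk hv
    | succ k => obtain ⟨m, hm, -⟩ := hk; exact ⟨m, c, hm⟩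
  obtain ⟨i0, j0, h0⟩ := harc
  obtain ⟨M, hM0, hM⟩ := window_bound hreg hA3 h0 ht0
  have hτ : ∀ s : ℝ, ∃ T, t0 ≤ s → s ≤ T ∧ ∫ t in s..T, W t i0 j0 = 1 := by
    intro s
    by_cases hs : t0 ≤ s
    · obtain ⟨T, hT⟩ := exists_window hreg h0 (ht0.trans hs)
      exact ⟨T, fun _ => hT⟩
    · exact ⟨0, fun h => absurd h hs⟩
  choose τ hτ using hτ
  have hA0 : 0 < A := by linarith
  set η : ℝ := Real.exp (-M) * (Real.exp (-M) * A⁻¹) with hη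
  have hη0 : 0 < η := by positivity
  have hAi : A⁻¹ ≤ 1 := inv_le_one_of_one_le₀ hA.le
  have hE1 : Real.exp (-M) ≤ 1 := Real.exp_le_one_iff.2 (by linarith)
  have hη1' : η ≤ Real.exp (-M) := by
    rw [hη]
    refine mul_le_of_le_one_right (Real.exp_pos _).le ?_
    exact mul_le_one₀ hE1 (by positivity) hAi
  have hη1 : η ≤ 1 := hη1'.trans hE1
  have hiter : ∀ k s, t0 ≤ s → s ≤ τ^[k] s := by
    intro k
    induction k with
    | zero => intro s _; exact le_rfl
    | succ k ih =>
      intro s hs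
      rw [Function.iterate_succ_apply]
      have := (hτ s hs).1
      exact this.trans (ih _ (hs.trans this))
  have keep : ∀ x, CSol n W t0 x → ∀ k v s d, t0 ≤ s → (∀ j, d ≤ x s j) →
      η ^ k * (x s v - d) ≤ x (τ^[k] s) v - d := by
    intro x hx k v
    induction k with
    | zero => intro s d _ _; simp
    | succ k ih =>
      intro s d hs hd
      rw [Function.iterate_succ_apply]
      have h1 := hτ s hs
      have h2 := step_keep hreg hx hs h1.1 hd (fun i => hM i s _ hs h1.1 h1.2) v
      have h3 := ih (τ s) d (hs.trans h1.1) (sol_lower hreg hx hs h1.1 hd)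
      refine le_trans ?_ h3
      rw [pow_succ, mul_assoc]
      refine mul_le_mul_of_nonneg_left ?_ (by positivity)
      exact le_trans (mul_le_mul_of_nonneg_right hη1' (sub_nonneg.2 (hd v))) h2
  have path : ∀ x, CSol n W t0 x → ∀ k u v, ReachIn (CPersistent n W) k u v →
      ∀ s d, t0 ≤ s → (∀ j, d ≤ x s j) →
      η ^ k * (x s u - d) ≤ x (τ^[k] s) v - d := by
    intro x hx k
    induction k with
    | zero =>
      intro u v huv s d _ _
      have : u = v := huv
      subst this
      simp
    | succ k ih =>
      rintro u v ⟨m, hum, hmv⟩ s d hs hd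
      rw [Function.iterate_succ_apply]
      have h1 := hτ s hs
      have hlow : A⁻¹ ≤ ∫ t in s..(τ s), W t m u := by
        have : ∫ t in s..(τ s), A⁻¹ * W t i0 j0 ≤ ∫ t in s..(τ s), W t m u :=
          intervalIntegral.integral_mono_on h1.1 ((W_int hreg i0 j0 _ _).const_mul _)
            (W_int hreg m u _ _)
            (fun t ht => (hA3 t (ht0.trans (hs.trans ht.1)) i0 j0 m u h0 hum).1)
        rwa [intervalIntegral.integral_const_mul, h1.2, mul_one] at this
      have h2 := step_gain hreg hx hs h1.1 hd (fun i => hM i s _ hs h1.1 h1.2) hum.1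
        (by positivity) hlow
      have h3 := ih m v hmv (τ s) d (hs.trans h1.1) (sol_lower hreg hx hs h1.1 hd)
      refine le_trans ?_ h3
      rw [pow_succ, mul_assoc]
      exact mul_le_mul_of_nonneg_left h2 (by positivity)
  choose kk hkk using hcen
  obtain ⟨N, hN⟩ := Finite.exists_le kk
  have all : ∀ x, CSol n W t0 x → ∀ v s d, t0 ≤ s → (∀ j, d ≤ x s j) →
      η ^ N * (x s c - d) ≤ x (τ^[N] s) v - d := by
    intro x hx v s d hs hd
    obtain ⟨r, hr⟩ := Nat.exists_eq_add_of_le (hN v)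
    have h1 := path x hx (kk v) c v (hkk v) s d hs hd
    have hs' := hiter (kk v) s hs
    have h2 := keep x hx r v (τ^[kk v] s) d (hs.trans hs') (sol_lower hreg hx hs hs' hd)
    rw [hr, add_comm, Function.iterate_add_apply]
    refine le_trans ?_ h2
    rw [pow_add, mul_assoc]
    exact mul_le_mul_of_nonneg_left h1 (by positivity)
  set ρ : ℝ := 1 - η ^ N with hρ
  have hρ1 : ρ < 1 := by have : 0 < η ^ N := by positivity
                         linarith
  have hρ0 : 0 ≤ ρ := by have : η ^ N ≤ 1 := pow_le_one₀ hη0.le hη1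
                         linarith
  have contr : ∀ s, t0 ≤ s → cH n x (τ^[N] s) ≤ ρ * cH n x s := by
    intro s hs
    have hlo : cMin n x s + η ^ N * (x s c - cMin n x s) ≤ cMin n x (τ^[N] s) :=
      le_ciInf fun v => by
        have := all x hx v s (cMin n x s) hs (cMin_le_x x s)
        linarith
    have hup : cMax n x (τ^[N] s) ≤ cMax n x s - η ^ N * (cMax n x s - x s c) :=
      ciSup_le fun v => by
        have := all _ (sol_neg hx) v s (- cMax n x s) hs
          (fun j => neg_le_neg (x_le_cMax x s j))
        linarith
    unfold cH
    rw [hρ]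
    nlinarith
  have anti : ∀ s t, t0 ≤ s → s ≤ t → cH n x t ≤ cH n x s := by
    intro s t hs hst
    have h1 : cMin n x s ≤ cMin n x t :=
      le_ciInf fun v => sol_lower hreg hx hs hst (cMin_le_x x s) v
    have h2 : cMax n x t ≤ cMax n x s :=
      ciSup_le fun v => sol_upper hreg hx hs hst (x_le_cMax x s) v
    unfold cH
    linarith
  have hnn : ∀ t, 0 ≤ cH n x t := fun t =>
    sub_nonneg.2 ((cMin_le_x x t c).trans (x_le_cMax x t c))
  have geo : ∀ k : ℕ, ∃ s, t0 ≤ s ∧ cH n x s ≤ ρ ^ k * cH n x t0 := by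
    intro k
    induction k with
    | zero => exact ⟨t0, le_rfl, by simp⟩
    | succ k ih =>
      obtain ⟨s, hs, h⟩ := ih
      refine ⟨τ^[N] s, hs.trans (hiter N s hs), (contr s hs).trans ?_⟩
      rw [pow_succ', mul_assoc]
      exact mul_le_mul_of_nonneg_left h hρ0
  have hlim : Tendsto (fun k : ℕ => ρ ^ k * cH n x t0) atTop (nhds 0) := by
    simpa using (tendsto_pow_atTop_nhds_zero_of_lt_one hρ0 hρ1).mul_const (cH n x t0)
  rw [Metric.tendsto_atTop]
  intro ε hε
  obtain ⟨k, hk⟩ := (hlim.eventually (gt_mem_nhds hε)).exists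
  obtain ⟨s, hs, hsk⟩ := geo k
  refine ⟨s, fun t ht => ?_⟩
  rw [Real.dist_eq, sub_zero, abs_of_nonneg (hnn t)]
  exact (anti s t hs ht).trans_lt (hsk.trans_lt hk)

end suff

/-- Under A3 and assuming solutions exist, global agreement holds iff the
persistent graph is quasi-strongly connected. -/
theorem continuous_agreement_iff_qsc
    (n : ℕ) (hn : 2 ≤ n) (W : ℝ → Fin n → Fin n → ℝ)
    (hreg : CRegular n W)
    (A : ℝ) (hA : 1 < A) (hA3 : CArcBalance n W A)
    (hex : CSolExists n W) :
    CAgree n W ↔ CQSC n W :=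
  ⟨necessity hn hreg hex, sufficiency hn hreg hA hA3⟩
end
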